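/- Let 0 < s ≤ 1 and d ≥ 1. There exists a constant K ≥ 1 (depending only on s and d) such that for all A ≥ 1, R > 0, 0 < t ≤ 1, 0 < γ ≤ 1, every measurable set E ⊆ B(0,R) with |E| ≥ γ|B(0,R)|, and every f ∈ C_M(B(0,R)) with ‖f‖_{L∞(B(0,R))} ≥ t, where M = (A^p (p!)^s)_{p∈ℕ}, one has both ‖f‖_{L∞(B(0,R))} ≤ C·‖f‖_{L∞(E)} and ‖f‖_{L²(B(0,R))} ≤ C·‖f‖_{L²(E)}, where C = (K/γ)^{K(1 − log t + (AR)^{1/(1−s)})} when 0 < s < 1 and C = (K/γ)^{K(1 − log t)e^{KAR}} when s = 1. -/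

import Mathlib

open MeasureTheory Filter
open scoped ENNReal NNReal

noncomputable section

abbrev Esp (d : ℕ) := EuclideanSpace ℝ (Fin d)

/-- Japanese bracket `⟨x⟩ = (1+‖x‖²)^{1/2}`. -/
def jap {d : ℕ} (x : Esp d) : ℝ := Real.sqrt (1 + ‖x‖ ^ 2)

/-- First-order partial derivative in direction `i`. -/
def pderivI {d : ℕ} (i : Fin d) (f : Esp d → ℂ) : Esp d → ℂ :=
  fun x => fderiv ℝ f x (EuclideanSpace.single i 1)

/-- Multi-index partial derivative `∂^β`. -/
def mderiv {d : ℕ} (β : Fin d → ℕ) (f : Esp d → ℂ) : Esp d → ℂ :=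
  Fin.foldr d (fun i g => (pderivI i)^[β i] g) f

/-- `ρ` is a contraction mapping: `|ρ(x)-ρ(y)| ≤ L‖x-y‖` for some `0 ≤ L < 1`. -/
def IsContractionMap {d : ℕ} (ρ : Esp d → ℝ) : Prop :=
  ∃ L : ℝ, 0 ≤ L ∧ L < 1 ∧ ∀ x y : Esp d, |ρ x - ρ y| ≤ L * ‖x - y‖

/-- `ω` is `γ`-thick with respect to the density `ρ`. -/
def IsThick {d : ℕ} (γ : ℝ) (ρ : Esp d → ℝ) (ω : Set (Esp d)) : Prop :=
  ∀ x : Esp d, ENNReal.ofReal γ * volume (Metric.ball x (ρ x)) ≤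
    volume (ω ∩ Metric.ball x (ρ x))

/-- The Bang degree `n_{t,M,r}`. -/
def bangDeg (M : ℕ → ℝ) (t r : ℝ) : ℕ :=
  sSup {N : ℕ | (∑ n ∈ Finset.Icc 1 N, if -Real.log t < (n : ℝ) then M (n - 1) / M n else 0) < r}

/-- `γ_M(p) = sup_{1≤j≤p} j (M_{j+1}M_{j-1}/M_j² - 1)`. -/
def gammaM (M : ℕ → ℝ) (p : ℕ) : ℝ :=
  ⨆ j : {j : ℕ // 1 ≤ j ∧ j ≤ p}, (j : ℝ) * (M (j + 1) * M (j - 1) / (M j) ^ 2 - 1)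

/-- `Γ_M(p) = 4 e^{4+4γ_M(p)}`. -/
def GammaM (M : ℕ → ℝ) (p : ℕ) : ℝ := 4 * Real.exp (4 + 4 * gammaM M p)

/-- Quasi-analyticity: `∑_{p≥1} M_{p-1}/M_p = +∞`. -/
def QuasiAnalytic (M : ℕ → ℝ) : Prop :=
  Tendsto (fun N => ∑ p ∈ Finset.Icc 1 N, M (p - 1) / M p) atTop atTop

/-- The quasi-analytic class `C_M(U)` on an open set `U ⊆ ℝ^d`. -/
def CMU {d : ℕ} (M : ℕ → ℝ) (U : Set (Esp d)) (f : Esp d → ℂ) : Prop :=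
  ContDiffOn ℝ (⊤ : ℕ∞) f U ∧
  ∀ β : Fin d → ℕ, ∀ x ∈ U, ‖mderiv β f x‖ ≤ M (∑ i, β i)

/-- The Gevrey-type sequence `M = (A^p (p!)^s)_p`. -/
def gevreySeq (A s : ℝ) (p : ℕ) : ℝ := A ^ p * (p.factorial : ℝ) ^ s

theorem rolle_tower (J : Set ℝ) (hJ : J.OrdConnected) (n : ℕ) : ∀ (H : ℕ → ℝ → ℝ)
    (_ : ∀ k, ∀ r ∈ J, HasDerivAt (H k) (H (k+1) r) r)
    (x : ℕ → ℝ) (_ : ∀ i < n, x i < x (i+1)) (_ : ∀ i ≤ n, x i ∈ J)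
    (_ : ∀ i ≤ n, H 0 (x i) = 0), ∃ ξ ∈ J, H n ξ = 0 := by
  induction n with
  | zero => intro H _ x _ hxJ hx0; exact ⟨x 0, hxJ 0 le_rfl, hx0 0 le_rfl⟩
  | succ n ih =>
    intro H hH x hx hxJ hx0
    have key : ∀ i : ℕ, ∃ y, i ≤ n → (x i < y ∧ y < x (i+1) ∧ H 1 y = 0) := by
      intro i
      by_cases hi : i ≤ n
      · have hsub : Set.Icc (x i) (x (i+1)) ⊆ J := hJ.out (hxJ i (by omega)) (hxJ (i+1) (by omega))
        obtain ⟨c, hc, hc0⟩ := exists_hasDerivAt_eq_zero (f := H 0) (f' := H 1)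
          (hx i (by omega))
          (fun y hy => ((hH 0 y (hsub hy)).continuousAt).continuousWithinAt)
          (by rw [hx0 i (by omega), hx0 (i+1) (by omega)])
          (fun y hy => hH 0 y (hsub (Set.Ioo_subset_Icc_self hy)))
        exact ⟨c, fun _ => ⟨hc.1, hc.2, hc0⟩⟩
      · exact ⟨0, fun h => absurd h hi⟩
    choose y hy using key
    refine ih (fun k => H (k+1)) (fun k r hr => hH (k+1) r hr) y ?_ ?_ ?_
    · intro i hi
      exact (hy i hi.le).2.1.trans (hy (i+1) hi).1
    · intro i hi
      exact hJ.out (hxJ i (by omega)) (hxJ (i+1) (by omega)) ⟨(hy i hi).1.le, (hy i hi).2.1.le⟩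
    · intro i hi; exact (hy i hi).2.2

theorem strict_of_step {n : ℕ} {x : ℕ → ℝ} {η : ℝ} (hx : ∀ i < n, x i + η ≤ x (i+1)) :
    ∀ k i, i + k ≤ n → x i + k * η ≤ x (i + k) := by
  intro k
  induction k with
  | zero => intro i _; simp
  | succ k ih =>
    intro i hi
    have h1 := ih i (by omega)
    have h2 := hx (i+k) (by omega)
    push_cast
    rw [← add_assoc]
    linarith

theorem injOn_of_strict {n : ℕ} {x : ℕ → ℝ} (hx : ∀ i < n, x i < x (i+1)) :
    Set.InjOn x (Finset.range (n+1)) := by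
  have : StrictMonoOn x (Set.Iic n) := by
    refine strictMonoOn_Iic_of_lt_succ ?_
    intro i hi
    exact hx i hi
  exact this.injOn.mono (by intro i hi; simp at hi ⊢; omega)

theorem divdiff_real (J : Set ℝ) (hJ : J.OrdConnected) (n : ℕ) (u : ℕ → ℝ → ℝ)
    (hu : ∀ k, ∀ r ∈ J, HasDerivAt (u k) (u (k+1) r) r)
    (x : ℕ → ℝ) (hx : ∀ i < n, x i < x (i+1)) (hxJ : ∀ i ≤ n, x i ∈ J) :
    ∃ ξ ∈ J, ∑ j ∈ Finset.range (n+1), u 0 (x j) *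
      (∏ k ∈ (Finset.range (n+1)).erase j, (x j - x k))⁻¹ = u n ξ / n.factorial := by
  have hinj := injOn_of_strict hx
  set q := Lagrange.interpolate (Finset.range (n+1)) x (fun j => u 0 (x j)) with hq
  obtain ⟨ξ, hξ, h0⟩ := rolle_tower J hJ n
    (fun k r => u k r - ((Polynomial.derivative^[k]) q).eval r)
    (fun k r hr => by
      refine (hu k r hr).sub ?_
      rw [Function.iterate_succ_apply']
      exact Polynomial.hasDerivAt _ _) x hx hxJ
    (fun i hi => by
      simp only [Function.iterate_zero, id]
      rw [hq, Lagrange.eval_interpolate_at_node _ hinj (by simp; omega)]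
      simp)
  refine ⟨ξ, hξ, ?_⟩
  have h1 : u n ξ = ((Polynomial.derivative^[n]) q).eval ξ := by
    simpa [sub_eq_zero] using h0
  rw [h1, hq]
  rw [Lagrange.iterate_derivative_interpolate _ hinj (by simp)]
  have hf : (n.factorial : ℝ) ≠ 0 := by positivity
  rw [eq_div_iff hf]
  simp [Polynomial.eval_finsetSum, mul_comm, Finset.mul_sum, div_eq_mul_inv]

theorem divdiff_complex (J : Set ℝ) (hJ : J.OrdConnected) (n : ℕ) (g : ℕ → ℝ → ℂ)
    (hg : ∀ k, ∀ r ∈ J, HasDerivAt (g k) (g (k+1) r) r) (D : ℝ)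
    (hD : ∀ r ∈ J, ‖g n r‖ / n.factorial ≤ D)
    (x : ℕ → ℝ) (hx : ∀ i < n, x i < x (i+1)) (hxJ : ∀ i ≤ n, x i ∈ J) :
    ‖∑ j ∈ Finset.range (n+1), g 0 (x j) *
      (((∏ k ∈ (Finset.range (n+1)).erase j, (x j - x k))⁻¹ : ℝ) : ℂ)‖ ≤ 2 * D := by
  have hre := divdiff_real J hJ n (fun k r => (g k r).re) (fun k r hr => by
    exact (Complex.reCLM.hasFDerivAt.comp_hasDerivAt r (hg k r hr))) x hx hxJ
  have him := divdiff_real J hJ n (fun k r => (g k r).im) (fun k r hr => by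
    exact (Complex.imCLM.hasFDerivAt.comp_hasDerivAt r (hg k r hr))) x hx hxJ
  obtain ⟨ξ, hξ, h1⟩ := hre
  obtain ⟨ζ, hζ, h2⟩ := him
  refine (Complex.norm_le_abs_re_add_abs_im _).trans ?_
  rw [Complex.re_sum, Complex.im_sum]
  simp only [Complex.re_mul_ofReal, Complex.im_mul_ofReal]
  rw [h1, h2, abs_div, abs_div, Nat.abs_cast]
  have e1 := Complex.abs_re_le_norm (g n ξ)
  have e2 := Complex.abs_im_le_norm (g n ζ)
  have := hD ξ hξ
  have := hD ζ hζ
  have a1 : |(g n ξ).re| / n.factorial ≤ ‖g n ξ‖ / n.factorial := by gcongr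
  have a2 : |(g n ζ).im| / n.factorial ≤ ‖g n ζ‖ / n.factorial := by gcongr
  linarith

-- separated points
theorem sep_points (n : ℕ) (η : ℝ) (hη : 0 < η) : ∀ (S : Set ℝ), BddBelow S →
    ENNReal.ofReal (2 * n * η) < volume S →
    ∃ x : ℕ → ℝ, (∀ i ≤ n, x i ∈ S) ∧ ∀ i < n, x i + η ≤ x (i+1) := by
  induction n with
  | zero =>
    intro S _ hS
    have : S.Nonempty := nonempty_of_measure_ne_zero (by
      have := (zero_le (a := ENNReal.ofReal (2 * (0:ℕ) * η))).trans_lt hS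
      exact this.ne')
    obtain ⟨a, ha⟩ := this
    exact ⟨fun _ => a, fun _ _ => ha, fun i hi => by omega⟩
  | succ n ih =>
    intro S hb hS
    have hne : S.Nonempty := nonempty_of_measure_ne_zero
      ((zero_le (a := ENNReal.ofReal (2 * (n+1:ℕ) * η))).trans_lt hS).ne'
    obtain ⟨a, haS, ha⟩ := exists_lt_of_csInf_lt hne (show sInf S < sInf S + η by linarith)
    have hsub : S ⊆ Set.Ico (sInf S) (sInf S + 2 * η) ∪ (S ∩ Set.Ici (a + η)) := by
      intro y hy
      by_cases h : y < sInf S + 2 * η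
      · exact Or.inl ⟨csInf_le hb hy, h⟩
      · refine Or.inr ⟨hy, ?_⟩
        simp; linarith
    have hm : volume S ≤ ENNReal.ofReal (2 * η) + volume (S ∩ Set.Ici (a + η)) := by
      refine (measure_mono hsub).trans ((measure_union_le _ _).trans ?_)
      gcongr
      simp
    have h2 : ENNReal.ofReal (2 * n * η) < volume (S ∩ Set.Ici (a + η)) := by
      by_contra hcon
      push Not at hcon
      have : volume S ≤ ENNReal.ofReal (2 * (n+1:ℕ) * η) := by
        refine hm.trans ((add_le_add le_rfl hcon).trans ?_)
        rw [← ENNReal.ofReal_add (by positivity) (by positivity)]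
        apply ENNReal.ofReal_le_ofReal
        push_cast; linarith
      exact absurd hS (not_lt.mpr this)
    obtain ⟨x, hx1, hx2⟩ := ih (S ∩ Set.Ici (a + η)) (hb.mono Set.inter_subset_left) h2
    refine ⟨fun i => Nat.casesOn i a x, ?_, ?_⟩
    · intro i hi
      cases i with
      | zero => exact haS
      | succ i => exact (hx1 i (by omega)).1
    · intro i hi
      cases i with
      | zero => exact (hx1 0 (by omega)).2
      | succ i => exact hx2 i (by omega)

theorem prod_sep_lower (n j : ℕ) (hj : j ≤ n) (η : ℝ) (hη : 0 < η) (x : ℕ → ℝ)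
    (hx : ∀ i < n, x i + η ≤ x (i+1)) :
    η ^ n * (j.factorial * (n - j).factorial) ≤
      ∏ k ∈ (Finset.range (n+1)).erase j, |x j - x k| := by
  have hst := strict_of_step hx
  have e1 : ∏ k ∈ (Finset.range (n+1)).erase j, |x j - x k|
      = ∏ k ∈ Finset.range (n+1), (if k = j then 1 else |x j - x k|) := by
    rw [← Finset.prod_erase (a := j) (s := Finset.range (n+1))
      (f := fun k => if k = j then (1:ℝ) else |x j - x k|) (by simp)]
    apply Finset.prod_congr rfl
    intro k hk
    simp [(Finset.mem_erase.1 hk).1]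
  obtain ⟨m, rfl⟩ := Nat.exists_eq_add_of_le hj
  rw [e1, show j + m + 1 = (j + 1) + m by ring, Finset.prod_range_add, Finset.prod_range_succ]
  simp only [if_true, mul_one]
  rw [← Finset.prod_range_reflect]
  have h1 : η ^ j * j.factorial ≤ ∏ k ∈ Finset.range j,
      (if j - 1 - k = j then (1:ℝ) else |x j - x (j - 1 - k)|) := by
    have : η ^ j * (j.factorial : ℝ) = ∏ k ∈ Finset.range j, (((k:ℝ)+1) * η) := by
      rw [Finset.prod_mul_distrib, ← Finset.prod_range_add_one_eq_factorial]
      push_cast; simp [mul_comm]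
    rw [this]
    apply Finset.prod_le_prod
    · intro k _; positivity
    · intro k hk
      have hk := Finset.mem_range.1 hk
      rw [if_neg (by omega)]
      have := hst (k+1) (j-1-k) (by omega)
      rw [show j - 1 - k + (k+1) = j by omega] at this
      push_cast at this
      refine le_trans ?_ (le_abs_self _)
      linarith
  have h2 : η ^ m * m.factorial ≤ ∏ k ∈ Finset.range m,
      (if j + 1 + k = j then (1:ℝ) else |x j - x (j + 1 + k)|) := by
    have : η ^ m * (m.factorial : ℝ) = ∏ k ∈ Finset.range m, (((k:ℝ)+1) * η) := by
      rw [Finset.prod_mul_distrib, ← Finset.prod_range_add_one_eq_factorial]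
      push_cast; simp [mul_comm]
    rw [this]
    apply Finset.prod_le_prod
    · intro k _; positivity
    · intro k hk
      have hk := Finset.mem_range.1 hk
      rw [if_neg (by omega)]
      have := hst (k+1) j (by omega)
      rw [show j + (k+1) = j + 1 + k by omega] at this
      push_cast at this
      rw [abs_sub_comm]
      refine le_trans ?_ (le_abs_self _)
      linarith
  have := mul_le_mul h1 h2 (by positivity) (le_trans (by positivity) h1)
  refine le_trans (le_of_eq ?_) this
  rw [show j + m - j = m by omega]
  ring

theorem step_lemma (J : Set ℝ) (hJ : J.OrdConnected) (n : ℕ) (g : ℕ → ℝ → ℂ)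
    (hg : ∀ k, ∀ r ∈ J, HasDerivAt (g k) (g (k+1) r) r) (D : ℝ)
    (hD : ∀ r ∈ J, ‖g (n+1) r‖ / (n+1).factorial ≤ D) (p Λ δ σ : ℝ) (hp : p ∈ J)
    (S : Set ℝ) (hSJ : S ⊆ J) (hS : S ⊆ Set.Ioc p (p + Λ)) (hδ : 0 < δ) (hδΛ : δ ≤ Λ)
    (hvol : ENNReal.ofReal δ ≤ volume S) (hσ0 : 0 ≤ σ)
    (hσ : ∀ y ∈ S, ‖g 0 y‖ ≤ σ) :
    ‖g 0 p‖ ≤ (8 * Real.exp 1 * Λ / δ) ^ (n+1) * σ + 2 * D * Λ ^ (n+1) := by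
  have hΛ : 0 < Λ := hδ.trans_le hδΛ
  have hD0 : 0 ≤ D := le_trans (by positivity) (hD p hp)
  set η : ℝ := δ / (4 * (n+1)) with hη
  have hη0 : 0 < η := by positivity
  obtain ⟨x, hxS, hx⟩ := sep_points n η hη0 S (bddBelow_Ioc.mono hS) (by
    refine lt_of_lt_of_le ?_ hvol
    rw [ENNReal.ofReal_lt_ofReal_iff hδ, hη, ← mul_div_assoc, div_lt_iff₀ (by positivity)]
    nlinarith [hδ])
  set y : ℕ → ℝ := fun i => Nat.casesOn i p x with hy
  have hy0 : y 0 = p := rfl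
  have hys : ∀ i, y (i+1) = x i := fun i => rfl
  have hxp : ∀ i ≤ n, 0 < x i - p := fun i hi => by linarith [(hS (hxS i hi)).1]
  have hxΛ : ∀ i ≤ n, x i - p ≤ Λ := fun i hi => by linarith [(hS (hxS i hi)).2]
  have hZ := divdiff_complex J hJ (n+1) g hg D hD y (by
      intro i hi
      cases i with
      | zero => rw [hys, hy0]; linarith [hxp 0 (by omega)]
      | succ i => rw [hys, hys]; linarith [hx i (by omega)])
    (by
      intro i hi
      cases i with
      | zero => exact hp
      | succ i => exact hSJ (hxS i (by omega)))
  rw [Finset.sum_range_succ'] at hZ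
  set w : ℕ → ℝ := fun j => (∏ k ∈ (Finset.range (n+1+1)).erase j, (y j - y k))⁻¹ with hw
  set P : ℝ := ∏ k ∈ Finset.range (n+1), (x k - p) with hP
  have hP0 : 0 < P := Finset.prod_pos fun k hk => hxp k (by simp at hk; omega)
  have hPΛ : P ≤ Λ ^ (n+1) := by
    calc P ≤ ∏ k ∈ Finset.range (n+1), Λ := Finset.prod_le_prod
            (fun k hk => (hxp k (by simp at hk; omega)).le)
            (fun k hk => (hxΛ k (by simp at hk; omega)))
      _ = _ := by simp
  have erase0 : (Finset.range (n+1+1)).erase 0 = (Finset.range (n+1)).image Nat.succ := by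
    ext k; cases k <;> simp
  have hw0 : |w 0| = P⁻¹ := by
    rw [hw]; simp only
    rw [abs_inv, Finset.abs_prod, erase0, Finset.prod_image (by intro a _ b _ h; simpa using h)]
    congr 1
    apply Finset.prod_congr rfl
    intro k hk
    rw [hy0, Nat.succ_eq_add_one, hys, abs_sub_comm, abs_of_pos (hxp k (by simp at hk; omega))]
  have eraseS : ∀ j, (Finset.range (n+1+1)).erase (j+1) =
      insert 0 (((Finset.range (n+1)).erase j).image Nat.succ) := by
    intro j; ext k; cases k <;> simp
  have hwj : ∀ j ≤ n, P * |w (j+1)| ≤ (Λ/η)^n * (n.choose j / n.factorial) := by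
    intro j hj
    have hlow := prod_sep_lower n j hj η hη0 x hx
    set Q : ℝ := ∏ k ∈ (Finset.range (n+1)).erase j, |x j - x k| with hQ
    have hQ0 : 0 < Q := lt_of_lt_of_le (by positivity) hlow
    have e1 : |w (j+1)| = ((x j - p) * Q)⁻¹ := by
      rw [hw]; simp only
      rw [abs_inv, Finset.abs_prod, eraseS, Finset.prod_insert (by simp),
        Finset.prod_image (by intro a _ b _ h; simpa using h)]
      rw [hy0, hys, abs_of_pos (hxp j hj)]
    have e2 : P ≤ (x j - p) * Λ ^ n := by
      rw [hP, ← Finset.mul_prod_erase (Finset.range (n+1)) _ (a := j) (by simp; omega)]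
      apply mul_le_mul_of_nonneg_left _ (hxp j hj).le
      calc _ ≤ ∏ k ∈ (Finset.range (n+1)).erase j, Λ := Finset.prod_le_prod
            (fun k hk => (hxp k (by simp at hk; omega)).le)
            (fun k hk => (hxΛ k (by simp at hk; omega)))
        _ = _ := by rw [Finset.prod_const, Finset.card_erase_of_mem (by simp; omega)]; simp
    rw [e1, Nat.cast_choose ℝ hj, div_pow]
    have hxj := hxp j hj
    calc P * ((x j - p) * Q)⁻¹ ≤ ((x j - p) * Λ ^ n) * ((x j - p) * Q)⁻¹ := by gcongr
      _ = Λ ^ n / Q := by field_simp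
      _ ≤ Λ ^ n / (η ^ n * (j.factorial * (n - j).factorial)) := by gcongr
      _ = _ := by field_simp
  have main : ‖g 0 p‖ ≤ P * (2 * D) + ∑ j ∈ Finset.range (n+1), σ * (P * |w (j+1)|) := by
    have t1 : ‖g 0 (y 0) * ((w 0 : ℝ) : ℂ)‖ ≤ 2 * D +
        ∑ j ∈ Finset.range (n+1), ‖g 0 (y (j+1)) * ((w (j+1) : ℝ) : ℂ)‖ := by
      have a := norm_sub_le (∑ j ∈ Finset.range (n+1), g 0 (y (j+1)) * ((w (j+1) : ℝ) : ℂ)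
        + g 0 (y 0) * ((w 0 : ℝ) : ℂ)) (∑ j ∈ Finset.range (n+1), g 0 (y (j+1)) * ((w (j+1) : ℝ) : ℂ))
      rw [add_sub_cancel_left] at a
      have b := norm_sum_le (Finset.range (n+1)) (fun j => g 0 (y (j+1)) * ((w (j+1) : ℝ) : ℂ))
      linarith
    rw [norm_mul, Complex.norm_real, Real.norm_eq_abs, hw0, hy0] at t1
    have t2 : ‖g 0 p‖ = P * (‖g 0 p‖ * P⁻¹) := by field_simp
    rw [t2]
    calc _ ≤ P * (2 * D + ∑ j ∈ Finset.range (n+1), ‖g 0 (y (j+1)) * ((w (j+1) : ℝ) : ℂ)‖) := by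
            gcongr
      _ ≤ P * (2 * D + ∑ j ∈ Finset.range (n+1), σ * |w (j+1)|) := by
          gcongr with j hj
          rw [norm_mul, Complex.norm_real, Real.norm_eq_abs]
          gcongr
          exact hσ _ (hxS j (by simp at hj; omega))
      _ = _ := by
          rw [mul_add, Finset.mul_sum]
          congr 1
          apply Finset.sum_congr rfl; intro j _; ring
  refine main.trans ?_
  rw [add_comm]
  have s1 : ∑ j ∈ Finset.range (n+1), σ * (P * |w (j+1)|) ≤
      (8 * Real.exp 1 * Λ / δ) ^ (n+1) * σ := by
    calc _ ≤ ∑ j ∈ Finset.range (n+1), σ * ((Λ/η)^n * (n.choose j / n.factorial)) := by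
            refine Finset.sum_le_sum fun j hj => ?_
            exact mul_le_mul_of_nonneg_left (hwj j (by simp at hj; omega)) hσ0
      _ = σ * ((Λ/η)^n * (2^n / n.factorial)) := by
          rw [← Finset.mul_sum, ← Finset.mul_sum, ← Finset.sum_div]
          congr 3
          exact_mod_cast Nat.sum_range_choose n
      _ = (8 * Λ / δ) ^ n * (((n+1 : ℕ):ℝ)^n / n.factorial) * σ := by
          rw [hη]
          have : Λ / (δ / (4 * ((n:ℝ)+1))) = (4 * Λ / δ) * (n+1) := by field_simp
          rw [this, mul_pow, show (8 * Λ / δ) = 2 * (4 * Λ / δ) by ring, mul_pow]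
          push_cast
          ring
      _ ≤ (8 * Λ / δ) ^ (n+1) * Real.exp (n+1:ℕ) * σ := by
          gcongr
          · rw [le_div_iff₀ hδ]; linarith
          · omega
          · exact Real.pow_div_factorial_le_exp _ (by positivity) _
      _ = _ := by
          rw [show 8 * Real.exp 1 * Λ / δ = (8 * Λ / δ) * Real.exp 1 by ring, mul_pow,
            ← Real.exp_nat_mul, mul_one]
  have s2 : P * (2 * D) ≤ 2 * D * Λ ^ (n+1) := by
    rw [mul_comm]; gcongr
  linarith

theorem pderivI_congr {d : ℕ} {U : Set (Esp d)} (hU : IsOpen U) (i : Fin d) {f g : Esp d → ℂ}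
    (h : Set.EqOn f g U) : Set.EqOn (pderivI i f) (pderivI i g) U := by
  intro x hx
  have : f =ᶠ[nhds x] g := h.eventuallyEq_of_mem (hU.mem_nhds hx)
  simp [pderivI, this.fderiv_eq]

theorem pderivI_iter_congr {d : ℕ} {U : Set (Esp d)} (hU : IsOpen U) (i : Fin d) (k : ℕ)
    {f g : Esp d → ℂ}
    (h : Set.EqOn f g U) : Set.EqOn ((pderivI i)^[k] f) ((pderivI i)^[k] g) U := by
  induction k with
  | zero => exact h
  | succ k ih => rw [Function.iterate_succ_apply', Function.iterate_succ_apply']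
                 exact pderivI_congr hU i ih

theorem pderivI_smooth {d : ℕ} {U : Set (Esp d)} (hU : IsOpen U) (i : Fin d) {f : Esp d → ℂ}
    (hf : ContDiffOn ℝ (⊤ : ℕ∞) f U) : ContDiffOn ℝ (⊤ : ℕ∞) (pderivI i f) U := by
  have h := hf.fderiv_of_isOpen (m := ((⊤ : ℕ∞) : WithTop ℕ∞)) hU (by simp)
  exact h.clm_apply contDiffOn_const

theorem pderivI_iter_smooth {d : ℕ} {U : Set (Esp d)} (hU : IsOpen U) (i : Fin d) (k : ℕ)
    {f : Esp d → ℂ}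
    (hf : ContDiffOn ℝ (⊤ : ℕ∞) f U) : ContDiffOn ℝ (⊤ : ℕ∞) ((pderivI i)^[k] f) U := by
  induction k with
  | zero => exact hf
  | succ k ih => rw [Function.iterate_succ_apply']
                 exact pderivI_smooth hU i ih

theorem pderivI_comm {d : ℕ} {U : Set (Esp d)} (hU : IsOpen U) (i j : Fin d) {f : Esp d → ℂ}
    (hf : ContDiffOn ℝ (⊤ : ℕ∞) f U) :
    Set.EqOn (pderivI i (pderivI j f)) (pderivI j (pderivI i f)) U := by
  intro x hx
  have hfx : ContDiffAt ℝ (⊤ : ℕ∞) f x := hf.contDiffAt (hU.mem_nhds hx)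
  have hsym := hfx.isSymmSndFDerivAt (by simp only [minSmoothness_of_isRCLikeNormedField]; exact WithTop.coe_le_coe.2 (le_top : (2:ℕ∞) ≤ ⊤))
  have hd : DifferentiableAt ℝ (fderiv ℝ f) x :=
    (hfx.fderiv_right (m := 1) (by norm_cast)).differentiableAt (by simp)
  have key : ∀ i j : Fin d, pderivI i (pderivI j f) x =
      fderiv ℝ (fderiv ℝ f) x (EuclideanSpace.single i 1) (EuclideanSpace.single j 1) := by
    intro i j
    unfold pderivI
    rw [fderiv_clm_apply hd (by fun_prop)]
    simp
  rw [key, key]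
  exact hsym _ _

theorem pderivI_iter_comm {d : ℕ} {U : Set (Esp d)} (hU : IsOpen U) (i j : Fin d) (k : ℕ)
    {f : Esp d → ℂ} (hf : ContDiffOn ℝ (⊤ : ℕ∞) f U) :
    Set.EqOn (pderivI i ((pderivI j)^[k] f)) ((pderivI j)^[k] (pderivI i f)) U := by
  induction k with
  | zero => exact fun x _ => rfl
  | succ k ih =>
    rw [Function.iterate_succ_apply', Function.iterate_succ_apply']
    exact (pderivI_comm hU i j (pderivI_iter_smooth hU j k hf)).trans (pderivI_congr hU j ih)

theorem foldr_smooth {d : ℕ} {U : Set (Esp d)} (hU : IsOpen U) (β : Fin d → ℕ)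
    {f : Esp d → ℂ} (hf : ContDiffOn ℝ (⊤ : ℕ∞) f U) (l : List (Fin d)) :
    ContDiffOn ℝ (⊤ : ℕ∞) (l.foldr (fun i g => (pderivI i)^[β i] g) f) U := by
  induction l with
  | nil => exact hf
  | cons a l ih => exact pderivI_iter_smooth hU a _ ih

theorem foldr_congr_notMem {d : ℕ} (β β' : Fin d → ℕ) (f : Esp d → ℂ) (l : List (Fin d))
    (h : ∀ i ∈ l, β i = β' i) :
    l.foldr (fun i g => (pderivI i)^[β i] g) f = l.foldr (fun i g => (pderivI i)^[β' i] g) f := by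
  induction l with
  | nil => rfl
  | cons a l ih =>
    simp only [List.foldr_cons]
    rw [ih (fun i hi => h i (by simp [hi])), h a (by simp)]

theorem pderivI_foldr {d : ℕ} {U : Set (Esp d)} (hU : IsOpen U) (β : Fin d → ℕ)
    {f : Esp d → ℂ} (hf : ContDiffOn ℝ (⊤ : ℕ∞) f U) (i : Fin d) (l : List (Fin d))
    (hl : l.Nodup) (hi : i ∈ l) :
    Set.EqOn (pderivI i (l.foldr (fun i g => (pderivI i)^[β i] g) f))
      (l.foldr (fun j g => (pderivI j)^[(β + Pi.single i 1 : Fin d → ℕ) j] g) f) U := by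
  induction l with
  | nil => simp at hi
  | cons a l ih =>
    rw [List.nodup_cons] at hl
    simp only [List.foldr_cons]
    by_cases hia : i = a
    · subst hia
      rw [foldr_congr_notMem (β + Pi.single i 1) β f l (by
        intro k hk
        have : k ≠ i := fun h => hl.1 (h ▸ hk)
        simp [this])]
      rw [← Function.iterate_succ_apply' (pderivI i)]
      simp only [Pi.add_apply, Pi.single_eq_same]
      exact fun x _ => rfl
    · have hil : i ∈ l := by simpa [hia] using hi
      have hai : (β + Pi.single i 1 : Fin d → ℕ) a = β a := by simp [Ne.symm hia]
      rw [hai]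
      exact (pderivI_iter_comm hU i a _ (foldr_smooth hU β hf l)).trans
        (pderivI_iter_congr hU a _ (ih hl.2 hil))

theorem mderiv_eq_foldr {d : ℕ} (β : Fin d → ℕ) (f : Esp d → ℂ) :
    mderiv β f = (List.finRange d).foldr (fun i g => (pderivI i)^[β i] g) f := by
  unfold mderiv
  rw [Fin.foldr_eq_finRange_foldr]

theorem pderivI_mderiv {d : ℕ} {U : Set (Esp d)} (hU : IsOpen U) (β : Fin d → ℕ)
    {f : Esp d → ℂ} (hf : ContDiffOn ℝ (⊤ : ℕ∞) f U) (i : Fin d) :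
    Set.EqOn (pderivI i (mderiv β f)) (mderiv (β + Pi.single i 1) f) U := by
  rw [mderiv_eq_foldr, mderiv_eq_foldr]
  exact pderivI_foldr hU β hf i _ (List.nodup_finRange d) (List.mem_finRange i)

/-- tower of directional derivatives -/
def tow {d : ℕ} (f : Esp d → ℂ) (x θ : Esp d) : ℕ → (Fin d → ℕ) → ℝ → ℂ
  | 0, β, r => mderiv β f (x + r • θ)
  | n+1, β, r => ∑ i, ((θ i : ℝ) : ℂ) * tow f x θ n (β + Pi.single i 1) r

theorem tow_hasDeriv {d : ℕ} {U : Set (Esp d)} (hU : IsOpen U) 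
    {f : Esp d → ℂ} (hf : ContDiffOn ℝ (⊤ : ℕ∞) f U) (x θ : Esp d) (n : ℕ) :
    ∀ (β : Fin d → ℕ) (r : ℝ), x + r • θ ∈ U →
      HasDerivAt (tow f x θ n β) (tow f x θ (n+1) β r) r := by
  induction n with
  | zero =>
    intro β r hr
    have hs : ContDiffOn ℝ (⊤ : ℕ∞) (mderiv β f) U := by
      rw [mderiv_eq_foldr]; exact foldr_smooth hU β hf _
    have hda : HasFDerivAt (mderiv β f) (fderiv ℝ (mderiv β f) (x + r • θ)) (x + r • θ) :=
      ((hs.contDiffAt (hU.mem_nhds hr)).differentiableAt (by simp)).hasFDerivAt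
    have hline : HasDerivAt (fun r : ℝ => x + r • θ) θ r := by
      simpa using ((hasDerivAt_id r).smul_const θ).const_add x
    have h := hda.comp_hasDerivAt r hline
    have e : fderiv ℝ (mderiv β f) (x + r • θ) θ = tow f x θ 1 β r := by
      have hθ : θ = ∑ i, θ i • EuclideanSpace.single i (1:ℝ) := by
        ext j; simp [Finset.sum_apply, Pi.single_apply]
      have e0 := congrArg (fderiv ℝ (mderiv β f) (x + r • θ)) hθ
      rw [map_sum] at e0
      rw [e0]
      simp only [tow]
      refine Finset.sum_congr rfl fun i _ => ?_
      rw [map_smul, ← pderivI_mderiv hU β hf i hr]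
      simp [pderivI]
    rw [e] at h
    exact h
  | succ n ih =>
    intro β r hr
    have : tow f x θ (n+1) β = fun r => ∑ i, ((θ i : ℝ) : ℂ) * tow f x θ n (β + Pi.single i 1) r := by
      funext r; rfl
    rw [this]
    have e : tow f x θ (n+1+1) β r = ∑ i, ((θ i : ℝ) : ℂ) * tow f x θ (n+1) (β + Pi.single i 1) r := rfl
    rw [e]
    exact HasDerivAt.fun_sum fun i _ => (ih _ r hr).const_mul _

theorem tow_bound {d : ℕ} {U : Set (Esp d)} 
    {f : Esp d → ℂ} {M : ℕ → ℝ} (hf : CMU M U f) (x θ : Esp d) (hθ : ‖θ‖ = 1) (n : ℕ) :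
    ∀ (β : Fin d → ℕ) (r : ℝ), x + r • θ ∈ U →
      ‖tow f x θ n β r‖ ≤ (d:ℝ)^n * M (∑ i, β i + n) := by
  induction n with
  | zero => intro β r hr; simpa [tow] using hf.2 β _ hr
  | succ n ih =>
    intro β r hr
    simp only [tow]
    refine (norm_sum_le _ _).trans ?_
    calc _ ≤ ∑ i : Fin d, ((d:ℝ)^n * M (∑ i, β i + (n+1))) := by
          refine Finset.sum_le_sum fun i _ => ?_
          rw [norm_mul, Complex.norm_real]
          have h1 : ‖θ i‖ ≤ 1 := hθ ▸ PiLp.norm_apply_le θ i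
          have h2 := ih (β + Pi.single i 1) r hr
          have h3 : ∑ k, (β + Pi.single i 1 : Fin d → ℕ) k + n = ∑ k, β k + (n+1) := by
            simp only [Pi.add_apply, Finset.sum_add_distrib, Finset.sum_pi_single']
            simp; ring
          rw [h3] at h2
          calc _ ≤ 1 * ‖tow f x θ n (β + Pi.single i 1) r‖ := by gcongr
            _ ≤ _ := by rw [one_mul]; exact h2
      _ = _ := by simp [pow_succ]; ring

theorem tow_zero {d : ℕ} (f : Esp d → ℂ) (x θ : Esp d) (r : ℝ) :
    tow f x θ 0 0 r = f (x + r • θ) := by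
  have : ∀ l : List (Fin d), l.foldr (fun i g => (pderivI i)^[(0 : Fin d → ℕ) i] g) f = f := by
    intro l; induction l with
    | nil => rfl
    | cons a l ih => simp only [List.foldr_cons, ih]; rfl
  simp only [tow]
  rw [mderiv_eq_foldr, this]

theorem exists_dir (d : ℕ) (hd : 1 ≤ d) (R γ : ℝ) (hR : 0 < R) (hγ : 0 < γ)
    (E : Set (Esp d)) (hE : E ⊆ Metric.ball 0 R) (hm : MeasurableSet E)
    (hvol : ENNReal.ofReal γ * volume (Metric.ball (0 : Esp d) R) ≤ volume E)
    (x0 : Esp d) (hx0 : x0 ∈ Metric.ball (0 : Esp d) R) :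
    ∃ θ : Esp d, ‖θ‖ = 1 ∧
      ENNReal.ofReal (γ * R / (d * 2 ^ d)) ≤ volume {r : ℝ | 0 < r ∧ x0 + r • θ ∈ E} := by
  by_contra hcon
  push Not at hcon
  have : Nonempty (Fin d) := ⟨⟨0, hd⟩⟩
  have : Nontrivial (Esp d) := inferInstance
  set δ : ℝ := γ * R / (d * 2 ^ d) with hδ
  have hd0 : (0:ℝ) < d := by exact_mod_cast hd
  set T : Set (Metric.sphere (0 : Esp d) 1 × Set.Ioi (0:ℝ)) :=
    {q | x0 + (q.2 : ℝ) • (q.1 : Esp d) ∈ E} with hT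
  have hTm : MeasurableSet T := by
    have : Continuous fun q : Metric.sphere (0 : Esp d) 1 × Set.Ioi (0:ℝ) =>
      x0 + (q.2 : ℝ) • (q.1 : Esp d) := by fun_prop
    exact this.measurable hm
  have hmp := (volume : Measure (Esp d)).measurePreserving_homeomorphUnitSphereProd
  have h1 := hmp.measure_preimage hTm.nullMeasurableSet
  have h2 : (volume : Measure (Esp d)).comap ((↑) : ({0}ᶜ : Set (Esp d)) → Esp d)
      (homeomorphUnitSphereProd (Esp d) ⁻¹' T) = volume E := by
    rw [comap_subtype_coe_apply (measurableSet_singleton _).compl]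
    have : ((↑) : ({0}ᶜ : Set (Esp d)) → Esp d) '' (homeomorphUnitSphereProd (Esp d) ⁻¹' T)
        = ((fun y => x0 + y) ⁻¹' E) \ {0} := by
      ext y
      constructor
      · rintro ⟨⟨z, hz⟩, hzT, rfl⟩
        refine ⟨?_, hz⟩
        have hz' : ‖z‖ ≠ 0 := by simpa using hz
        simpa [hT, smul_smul, hz'] using hzT
      · rintro ⟨hy, hy0⟩
        refine ⟨⟨y, hy0⟩, ?_, rfl⟩
        have hz' : ‖y‖ ≠ 0 := by simpa using hy0
        simpa [hT, smul_smul, hz'] using hy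
    rw [this, measure_sdiff_null (by simp), measure_preimage_add]
  rw [h2, Measure.prod_apply hTm] at h1
  have hfin : Module.finrank ℝ (Esp d) = d := by simp
  have h3 : ∀ θ : Metric.sphere (0 : Esp d) 1,
      Measure.volumeIoiPow (Module.finrank ℝ (Esp d) - 1) (Prod.mk θ ⁻¹' T) ≤
        ENNReal.ofReal ((2 * R) ^ (d-1)) * ENNReal.ofReal δ := by
    intro θ
    have hθ : ‖(θ : Esp d)‖ = 1 := by simp
    rw [hfin, Measure.volumeIoiPow, withDensity_apply _ (hTm.preimage (by fun_prop))]
    calc _ ≤ ∫⁻ r in (Prod.mk θ ⁻¹' T), ENNReal.ofReal ((2 * R) ^ (d-1))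
          ∂(Measure.comap Subtype.val (volume : Measure ℝ)) := by
          refine setLIntegral_mono' (hTm.preimage (by fun_prop)) ?_
          intro r hr
          apply ENNReal.ofReal_le_ofReal
          have hr0 : (0:ℝ) < r := r.2
          gcongr
          have hmem : x0 + (r : ℝ) • (θ : Esp d) ∈ E := hr
          have a1 := mem_ball_zero_iff.1 (hE hmem)
          have a2 := mem_ball_zero_iff.1 hx0
          have a3 : ‖(r : ℝ) • (θ : Esp d)‖ = r := by
            rw [norm_smul, hθ, mul_one, Real.norm_eq_abs, abs_of_pos hr0]
          have a4 := norm_sub_le (x0 + (r : ℝ) • (θ : Esp d)) x0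
          rw [add_sub_cancel_left, a3] at a4
          linarith
      _ = ENNReal.ofReal ((2 * R) ^ (d-1)) * (Measure.comap Subtype.val (volume : Measure ℝ)) (Prod.mk θ ⁻¹' T) := by
          rw [setLIntegral_const]
      _ ≤ _ := by
          gcongr
          rw [comap_subtype_coe_apply measurableSet_Ioi]
          refine le_trans (measure_mono ?_) (hcon θ hθ).le
          rintro _ ⟨r, hr, rfl⟩
          exact ⟨r.2, hr⟩
  have h4 : volume E ≤ ENNReal.ofReal ((2 * R) ^ (d-1)) * ENNReal.ofReal δ *
      (d * volume (Metric.ball (0 : Esp d) 1)) := by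
    rw [h1]
    refine (lintegral_mono h3).trans ?_
    rw [lintegral_const, Measure.toSphere_apply_univ, hfin]
  have h5 := hvol.trans h4
  rw [Measure.addHaar_ball _ _ hR.le, hfin] at h5
  set V := volume (Metric.ball (0 : Esp d) 1) with hV
  have hV0 : V ≠ 0 := (Metric.measure_ball_pos _ _ one_pos).ne'
  have hVt : V ≠ ⊤ := measure_ball_lt_top.ne
  have h6 : ENNReal.ofReal (γ * R ^ d) * V ≤ ENNReal.ofReal ((2 * R) ^ (d-1) * δ * d) * V := by
    rw [ENNReal.ofReal_mul hγ.le, ENNReal.ofReal_mul (by positivity),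
      ENNReal.ofReal_mul (by positivity), ENNReal.ofReal_natCast]
    rw [← mul_assoc, ← mul_assoc] at h5
    exact h5
  rw [ENNReal.mul_le_mul_iff_left hV0 hVt, ENNReal.ofReal_le_ofReal_iff (by positivity)] at h6
  obtain ⟨k, rfl⟩ : ∃ k, d = k + 1 := ⟨d - 1, by omega⟩
  have : (2 * R) ^ (k + 1 - 1) * δ * ((k+1 : ℕ):ℝ) = γ * R ^ (k+1) / 2 := by
    rw [hδ]; simp only [Nat.add_sub_cancel]
    field_simp
    ring
  rw [this] at h6
  have : 0 < γ * R ^ (k+1) := by positivity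
  linarith

/-- Data obtained by restricting `f` to a good ray. -/
theorem ray_data (s A R γ : ℝ) (d : ℕ) (hd : 1 ≤ d) (hR : 0 < R) (hγ : 0 < γ)
    (E : Set (Esp d)) (hE : E ⊆ Metric.ball 0 R) (hm : MeasurableSet E)
    (hvol : ENNReal.ofReal γ * volume (Metric.ball (0 : Esp d) R) ≤ volume E)
    (f : Esp d → ℂ) (hf : CMU (gevreySeq A s) (Metric.ball 0 R) f)
    (x0 : Esp d) (hx0 : x0 ∈ Metric.ball (0 : Esp d) R) (σ : ℝ) (hσ : ∀ x ∈ E, ‖f x‖ ≤ σ) :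
    ∃ (J : Set ℝ) (g : ℕ → ℝ → ℂ) (S : Set ℝ), J.OrdConnected ∧
      (∀ k, ∀ r ∈ J, HasDerivAt (g k) (g (k+1) r) r) ∧
      (∀ n, ∀ r ∈ J, ‖g n r‖ ≤ (d * A) ^ n * (n.factorial : ℝ) ^ s) ∧
      (0 : ℝ) ∈ J ∧ ‖g 0 0‖ = ‖f x0‖ ∧ S ⊆ J ∧ S ⊆ Set.Ioc 0 (2 * R) ∧
      ENNReal.ofReal (γ * R / (d * 2 ^ d)) ≤ volume S ∧ ∀ y ∈ S, ‖g 0 y‖ ≤ σ := by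
  obtain ⟨θ, hθ, hS⟩ := exists_dir d hd R γ hR hγ E hE hm hvol x0 hx0
  refine ⟨{r | x0 + r • θ ∈ Metric.ball (0 : Esp d) R}, fun n => tow f x0 θ n 0,
    {r : ℝ | 0 < r ∧ x0 + r • θ ∈ E}, ?_, ?_, ?_, ?_, ?_, ?_, ?_, hS, ?_⟩
  · have hc := (convex_ball (0 : Esp d) R).affine_preimage
        (AffineMap.lineMap x0 (x0 + θ) : ℝ →ᵃ[ℝ] Esp d)
    have he : {r : ℝ | x0 + r • θ ∈ Metric.ball (0 : Esp d) R} =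
        (AffineMap.lineMap x0 (x0 + θ) : ℝ →ᵃ[ℝ] Esp d) ⁻¹' Metric.ball (0 : Esp d) R := by
      ext r
      simp [AffineMap.lineMap_apply, add_comm]
    rw [he]
    exact hc.ordConnected
  · intro k r hr
    exact tow_hasDeriv Metric.isOpen_ball hf.1 x0 θ k 0 r hr
  · intro n r hr
    have := tow_bound hf x0 θ hθ n 0 r hr
    simp only [gevreySeq, Pi.zero_apply, Finset.sum_const_zero, zero_add] at this
    rw [mul_pow, mul_assoc]; exact this
  · simpa using hx0
  · simp only [tow_zero]; simp
  · intro r hr; exact hE hr.2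
  · intro r hr
    refine ⟨hr.1, ?_⟩
    have a1 := mem_ball_zero_iff.1 (hE hr.2)
    have a2 := mem_ball_zero_iff.1 hx0
    have a3 : ‖r • θ‖ = r := by
      rw [norm_smul, hθ, mul_one, Real.norm_eq_abs, abs_of_pos hr.1]
    have a4 := norm_sub_le (x0 + r • θ) x0
    rw [add_sub_cancel_left, a3] at a4
    linarith
  · intro y hy
    simp only [tow_zero]
    exact hσ _ hy.2

theorem delta_le (d : ℕ) (hd : 1 ≤ d) (R γ : ℝ) (hR : 0 < R) (hγ1 : γ ≤ 1) :
    γ * R / (d * 2 ^ d) ≤ R := by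
  have hd0 : (1:ℝ) ≤ d := by exact_mod_cast hd
  have h2 : (1:ℝ) ≤ 2 ^ d := one_le_pow₀ (by norm_num)
  rw [div_le_iff₀ (by positivity)]
  have : 1 ≤ (d:ℝ) * 2 ^ d := one_le_mul_of_one_le_of_one_le hd0 h2
  nlinarith

theorem exp_one_le_G (c γ : ℝ) (hc : Real.exp 1 ≤ c) (hγ : 0 < γ) (hγ1 : γ ≤ 1) :
    Real.exp 1 ≤ c / γ := by
  rw [le_div_iff₀ hγ]
  have := Real.exp_pos 1
  nlinarith

theorem small_gevrey (s b : ℝ) (hs0 : 0 < s) (hs1 : s < 1) (hb : 0 < b) (N : ℕ)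
    (hN : (Real.exp 2 * b) ^ (1 / (1 - s)) ≤ N) :
    b ^ N * (N.factorial : ℝ) ^ s / N.factorial ≤ Real.exp (-N) := by
  have h1s : 0 < 1 - s := by linarith
  have hN0 : (0:ℝ) < N := lt_of_lt_of_le (by positivity) hN
  have h1 : Real.exp 2 * b ≤ (N:ℝ) ^ (1 - s) := by
    have := Real.rpow_le_rpow (by positivity) hN h1s.le
    rwa [← Real.rpow_mul (by positivity), one_div, inv_mul_cancel₀ h1s.ne', Real.rpow_one] at this
  have hf : (0:ℝ) < N.factorial := by positivity
  have h2 : (N:ℝ) ^ N / Real.exp N ≤ N.factorial := by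
    have := Real.pow_div_factorial_le_exp (N:ℝ) hN0.le N
    rw [div_le_iff₀ (by positivity)] at this ⊢
    linarith
  have h3 : (N.factorial : ℝ) ^ s / N.factorial = ((N.factorial : ℝ) ^ (1 - s))⁻¹ := by
    rw [← Real.rpow_neg hf.le, neg_sub, Real.rpow_sub hf, Real.rpow_one]
  rw [mul_div_assoc, h3, ← div_eq_mul_inv, div_le_iff₀ (by positivity)]
  have h4 : ((N:ℝ) ^ N / Real.exp N) ^ (1 - s) ≤ (N.factorial : ℝ) ^ (1 - s) :=
    Real.rpow_le_rpow (by positivity) h2 h1s.le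
  have h5 : ((N:ℝ) ^ N / Real.exp N) ^ (1 - s) = ((N:ℝ) ^ (1-s)) ^ N * Real.exp (-(1 - s) * N) := by
    rw [Real.div_rpow (by positivity) (by positivity), ← Real.rpow_natCast, ← Real.rpow_natCast,
      ← Real.rpow_mul hN0.le, ← Real.rpow_mul hN0.le, mul_comm (N:ℝ) (1 - s), ← Real.exp_mul,
      div_eq_mul_inv, ← Real.exp_neg]
    congr 2; ring
  have h6 : (Real.exp 2 * b) ^ N ≤ ((N:ℝ) ^ (1-s)) ^ N := by gcongr
  calc b ^ N = Real.exp (-N) * ((Real.exp 2 * b) ^ N * Real.exp (-N)) := by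
        rw [mul_pow, ← Real.exp_nat_mul]
        have : Real.exp (-N) * (Real.exp (N * 2) * b ^ N * Real.exp (-N)) =
          (Real.exp (-N) * Real.exp (N * 2) * Real.exp (-N)) * b ^ N := by ring
        rw [this, ← Real.exp_add, ← Real.exp_add]
        ring_nf; simp
    _ ≤ Real.exp (-N) * (((N:ℝ) ^ (1-s)) ^ N * Real.exp (-(1 - s) * N)) := by
        have hle : Real.exp (-N) ≤ Real.exp (-(1 - s) * N) := Real.exp_le_exp.2 (by nlinarith)
        gcongr
    _ ≤ _ := by
        rw [← h5]; gcongr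

/-- A common final step. -/
theorem final_pow (c γ a b K X σ : ℝ) (hc : Real.exp 1 ≤ c) (hγ : 0 < γ) (hγ1 : γ ≤ 1) (hσ : 0 ≤ σ)
    (N : ℕ) (h : Real.exp (-a) ≤ (c / γ) ^ N * σ) (hN : (N:ℝ) ≤ b) (hab : a + b ≤ K * X)
    (ha : 0 ≤ a) (hK : c ≤ K) : 1 ≤ (K / γ) ^ (K * X) * σ := by
  have hG := exp_one_le_G c γ hc hγ hγ1
  set G := c / γ with hGd
  have hc0 : 0 < c := (Real.exp_pos 1).trans_le hc
  have hG0 : 0 < G := by positivity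
  have hG1 : 1 ≤ G := le_trans (by have := Real.add_one_le_exp (1:ℝ); linarith) hG
  have h1 : 1 ≤ Real.exp a * (G ^ N * σ) := by
    have := mul_le_mul_of_nonneg_left h (Real.exp_pos a).le
    rwa [← Real.exp_add, add_neg_cancel, Real.exp_zero] at this
  have h2 : Real.exp a ≤ G ^ a := by
    have := Real.rpow_le_rpow (Real.exp_pos 1).le hG ha
    rwa [← Real.exp_mul, one_mul] at this
  have h3 : G ^ N ≤ G ^ b := by
    rw [← Real.rpow_natCast]
    exact Real.rpow_le_rpow_of_exponent_le hG1 hN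
  calc 1 ≤ Real.exp a * (G ^ N * σ) := h1
    _ ≤ G ^ a * (G ^ b * σ) := by gcongr
    _ = G ^ (a + b) * σ := by rw [Real.rpow_add hG0]; ring
    _ ≤ G ^ (K * X) * σ := by gcongr
    _ ≤ (K / γ) ^ (K * X) * σ := by
        have hKX : 0 ≤ K * X := by
          have : (0:ℝ) ≤ N := by positivity
          linarith
        have : G ≤ K / γ := by rw [hGd]; gcongr
        gcongr

theorem arith_lt (c c1 l Y : ℝ) (hc : 0 ≤ c) (hc1 : 0 ≤ c1) (hY : 0 ≤ Y) (hl : 0 ≤ -l) :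
    2 - l + (4 - l + c1 * Y) ≤ (c + 6 + c1) * (1 - l + Y) := by
  have a1 : 0 ≤ c * (1 - l + Y) := mul_nonneg hc (by linarith)
  have a2 : 0 ≤ c1 * (1 - l) := mul_nonneg hc1 (by linarith)
  have e : (c + 6 + c1) * (1 - l + Y) = c * (1 - l + Y)
      + c1 * (1 - l) + c1 * Y + 6 * (1 - l + Y) := by ring
  rw [e]; linarith

theorem main_lt (s : ℝ) (hs0 : 0 < s) (hs1 : s < 1) (d : ℕ) (hd : 1 ≤ d) :
    ∃ K : ℝ, 1 ≤ K ∧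
      ∀ (A R t γ : ℝ), 1 ≤ A → 0 < R → 0 < t → t ≤ 1 → 0 < γ → γ ≤ 1 →
        ∀ E : Set (Esp d), E ⊆ Metric.ball 0 R → MeasurableSet E →
          ENNReal.ofReal γ * volume (Metric.ball (0 : Esp d) R) ≤ volume E →
          ∀ f : Esp d → ℂ, CMU (gevreySeq A s) (Metric.ball 0 R) f →
          ∀ x0 ∈ Metric.ball (0 : Esp d) R, t / 2 ≤ ‖f x0‖ →
          ∀ σ : ℝ, 0 ≤ σ → (∀ x ∈ E, ‖f x‖ ≤ σ) →
          1 ≤ (K / γ) ^ (K * (1 - Real.log t + (A * R) ^ (1 / (1 - s)))) * σ := by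
  have hd0 : (1:ℝ) ≤ d := by exact_mod_cast hd
  set c1 : ℝ := (Real.exp 2 * (2 * d)) ^ (1 / (1 - s)) with hc1
  have hc10 : 0 < c1 := by positivity
  set c : ℝ := 8 * Real.exp 1 * 2 * (d * 2 ^ d) with hc
  have hce : Real.exp 1 ≤ c := by
    have h2 : (1:ℝ) ≤ 2 ^ d := one_le_pow₀ (by norm_num)
    have : 1 ≤ (d:ℝ) * 2 ^ d := one_le_mul_of_one_le_of_one_le hd0 h2
    have := Real.exp_pos 1
    nlinarith
  refine ⟨c + 6 + c1, ?_, ?_⟩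
  · have := Real.exp_pos 1; linarith
  intro A R t γ hA hR ht ht1 hγ hγ1 E hE hm hvol f hf x0 hx0 hfx0 σ hσ0 hσ
  obtain ⟨J, g, S, hJ, hg, hgb, h0J, hg0, hSJ, hSI, hSv, hSσ⟩ :=
    ray_data s A R γ d hd hR hγ E hE hm hvol f hf x0 hx0 σ hσ
  set Y : ℝ := (A * R) ^ (1 / (1 - s)) with hY
  have hY0 : 0 ≤ Y := by positivity
  have hlog : 0 ≤ - Real.log t := by linarith [Real.log_nonpos ht.le ht1]
  obtain ⟨n, hn⟩ : ∃ n : ℕ, ⌈3 - Real.log t + c1 * Y⌉₊ = n + 1 := by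
    refine ⟨⌈3 - Real.log t + c1 * Y⌉₊ - 1, ?_⟩
    have : 0 < ⌈3 - Real.log t + c1 * Y⌉₊ := Nat.ceil_pos.2 (by nlinarith)
    omega
  have hN1 : 3 - Real.log t + c1 * Y ≤ ((n+1 : ℕ) : ℝ) := hn ▸ Nat.le_ceil _
  have hN2 : ((n+1 : ℕ) : ℝ) ≤ 3 - Real.log t + c1 * Y + 1 := by
    rw [← hn]; exact (Nat.ceil_lt_add_one (by nlinarith)).le
  set δ : ℝ := γ * R / (d * 2 ^ d) with hδ
  have hδ0 : 0 < δ := by positivity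
  have hδR : δ ≤ R := delta_le d hd R γ hR hγ1
  have hB : 0 < d * A * (2 * R) := by positivity
  have hsm := small_gevrey s (d * A * (2 * R)) hs0 hs1 hB (n+1) (by
    refine le_trans ?_ hN1
    have : Real.exp 2 * (d * A * (2 * R)) = (Real.exp 2 * (2 * d)) * (A * R) := by ring
    rw [this, Real.mul_rpow (by positivity) (by positivity)]
    linarith)
  have hstep := step_lemma J hJ n g hg
    ((d * A) ^ (n+1) * ((n+1).factorial : ℝ) ^ s / (n+1).factorial)
    (fun r hr => by gcongr; exact hgb (n+1) r hr) 0 (2 * R) δ σ h0J S hSJ (by simpa using hSI) hδ0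
    (by linarith) hSv hσ0 hSσ
  rw [hg0] at hstep
  have hG : 8 * Real.exp 1 * (2 * R) / δ = c / γ := by
    rw [hδ, hc]; field_simp
  rw [hG] at hstep
  have hrem : 2 * ((d * A) ^ (n+1) * ((n+1).factorial : ℝ) ^ s / (n+1).factorial) * (2 * R) ^ (n+1)
      ≤ t / 4 := by
    have e : 2 * ((d * A) ^ (n+1) * ((n+1).factorial : ℝ) ^ s / (n+1).factorial) * (2 * R) ^ (n+1)
      = 2 * ((d * A * (2 * R)) ^ (n+1) * ((n+1).factorial : ℝ) ^ s / (n+1).factorial) := by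
      rw [mul_pow (d * A : ℝ) (2 * R)]; ring
    rw [e]
    have h1 : Real.exp (-((n+1:ℕ):ℝ)) ≤ Real.exp (-3) * t := by
      conv_rhs => rw [← Real.exp_log ht]
      rw [← Real.exp_add]
      apply Real.exp_le_exp.2
      nlinarith
    have h8 : Real.exp (-3) ≤ 1 / 8 := by
      rw [Real.exp_neg, one_div]
      apply inv_anti₀ (by norm_num)
      have := Real.add_one_le_exp (1:ℝ)
      have e3 : Real.exp 3 = Real.exp 1 ^ 3 := by rw [← Real.exp_nat_mul]; norm_num
      rw [e3]
      calc (8:ℝ) = 2 ^ 3 := by norm_num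
        _ ≤ _ := by gcongr; linarith
    nlinarith
  refine final_pow c γ (2 - Real.log t) (4 - Real.log t + c1 * Y) _ _ σ hce hγ hγ1 hσ0 (n+1) ?_
    (by linarith) ?_ (by linarith) (by linarith)
  · have h4 : Real.exp (-(2 - Real.log t)) ≤ t / 4 := by
      have : -(2 - Real.log t) = -2 + Real.log t := by ring
      rw [this, Real.exp_add, Real.exp_log ht]
      have h8 : Real.exp (-2) ≤ 1 / 4 := by
        rw [Real.exp_neg, one_div]
        apply inv_anti₀ (by norm_num)
        have := Real.add_one_le_exp (1:ℝ)
        have e3 : Real.exp 2 = Real.exp 1 ^ 2 := by rw [← Real.exp_nat_mul]; norm_num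
        rw [e3]
        calc (4:ℝ) = 2 ^ 2 := by norm_num
          _ ≤ _ := by gcongr; linarith
      nlinarith
    linarith
  · exact arith_lt c c1 _ Y ((Real.exp_pos 1).le.trans hce) hc10.le hY0 hlog

theorem step_analytic (J : Set ℝ) (hJ : J.OrdConnected) (g : ℕ → ℝ → ℂ)
    (hg : ∀ k, ∀ r ∈ J, HasDerivAt (g k) (g (k+1) r) r) (B : ℝ)
    (hB : ∀ n, ∀ r ∈ J, ‖g n r‖ ≤ B ^ n * (n.factorial : ℝ)) (hB0 : 0 ≤ B)
    (p Λ δ σ lam : ℝ) (hp : p ∈ J) (hlam : 1 ≤ lam) (hgp : Real.exp (1 - lam) ≤ ‖g 0 p‖)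
    (hBΛ : B * Λ ≤ Real.exp (-1))
    (S : Set ℝ) (hSJ : S ⊆ J) (hS : S ⊆ Set.Ioc p (p + Λ)) (hδ : 0 < δ) (hδΛ : δ ≤ Λ)
    (hvol : ENNReal.ofReal δ ≤ volume S) (hσ0 : 0 ≤ σ)
    (hσ : ∀ y ∈ S, ‖g 0 y‖ ≤ σ) :
    ∃ N : ℕ, (N:ℝ) ≤ lam + 3 ∧ Real.exp (-lam) ≤ (8 * Real.exp 1 * Λ / δ) ^ N * σ := by
  obtain ⟨n, hn⟩ : ∃ n : ℕ, ⌈lam + 2⌉₊ = n + 1 := by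
    refine ⟨⌈lam + 2⌉₊ - 1, ?_⟩
    have : 0 < ⌈lam + 2⌉₊ := Nat.ceil_pos.2 (by linarith)
    omega
  have hN1 : lam + 2 ≤ ((n+1 : ℕ) : ℝ) := hn ▸ Nat.le_ceil _
  have hN2 : ((n+1 : ℕ) : ℝ) ≤ lam + 2 + 1 := by
    rw [← hn]; exact (Nat.ceil_lt_add_one (by linarith)).le
  refine ⟨n+1, by linarith, ?_⟩
  have hstep := step_lemma J hJ n g hg (B ^ (n+1))
    (fun r hr => by
      rw [div_le_iff₀ (by positivity)]; exact hB (n+1) r hr) p Λ δ σ hp S hSJ hS hδ hδΛ hvol hσ0 hσ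
  have hrem : 2 * B ^ (n+1) * Λ ^ (n+1) ≤ 2 * Real.exp (-lam - 2) := by
    rw [mul_assoc, ← mul_pow]
    gcongr
    calc (B * Λ) ^ (n+1) ≤ Real.exp (-1) ^ (n+1) := by
          gcongr
          exact mul_nonneg hB0 (hδ.le.trans hδΛ)
      _ = Real.exp (-((n+1:ℕ):ℝ)) := by rw [← Real.exp_nat_mul]; congr 1; ring
      _ ≤ _ := Real.exp_le_exp.2 (by linarith)
  have e1 : Real.exp (1 - lam) = Real.exp 1 * Real.exp (-lam) := by rw [← Real.exp_add]; ring_nf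
  have e2 : Real.exp (-lam - 2) = Real.exp (-2) * Real.exp (-lam) := by rw [← Real.exp_add]; ring_nf
  have h1 : 2 ≤ Real.exp 1 := by have := Real.add_one_le_exp (1:ℝ); linarith
  have h2 : Real.exp (-2) ≤ 1 / 2 := by
    rw [Real.exp_neg, one_div]
    apply inv_anti₀ (by norm_num)
    have := Real.add_one_le_exp (2:ℝ); linarith
  have h3 := Real.exp_pos (-lam)
  rw [e1] at hgp
  rw [e2] at hrem
  nlinarith

theorem exp_bound16 : 8 * Real.exp 1 * 2 ≤ Real.exp 4 := by
  have h1 : (2.7:ℝ) ≤ Real.exp 1 := by have := Real.exp_one_gt_d9; linarith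
  have e4 : Real.exp 4 = Real.exp 1 * Real.exp 1 ^ 3 := by
    rw [← Real.exp_nat_mul, ← Real.exp_add]; norm_num
  rw [e4]
  have : (2.7:ℝ) ^ 3 ≤ Real.exp 1 ^ 3 := by gcongr
  have := Real.exp_pos 1
  nlinarith

theorem chain_analytic (J : Set ℝ) (hJ : J.OrdConnected) (g : ℕ → ℝ → ℂ)
    (hg : ∀ k, ∀ r ∈ J, HasDerivAt (g k) (g (k+1) r) r) (B : ℝ)
    (hB : ∀ n, ∀ r ∈ J, ‖g n r‖ ≤ B ^ n * (n.factorial : ℝ)) (hB0 : 0 ≤ B)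
    (h lam : ℝ) (hh : 0 < h) (h0J : (0:ℝ) ∈ J) (hlam : 1 ≤ lam)
    (hg0 : Real.exp (1 - lam) ≤ ‖g 0 0‖)
    (hBh : B * (2 * h) ≤ Real.exp (-1)) (k : ℕ) (z : ℝ) (hz : z ∈ J) (hzk : k * h ≤ z) :
    ∀ i ≤ k, ∃ p ∈ J, ((i:ℝ) - 1) * h ≤ p ∧ p ≤ i * h ∧
      Real.exp (1 - 19 ^ i * lam) ≤ ‖g 0 p‖ := by
  intro i
  induction i with
  | zero => intro _; exact ⟨0, h0J, by simp; exact hh.le, by simp, by simpa using hg0⟩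
  | succ i ih =>
    intro hi
    obtain ⟨p, hpJ, hp1, hp2, hgp⟩ := ih (by omega)
    have hiz : ((i+1 : ℕ):ℝ) * h ≤ z := by
      refine le_trans ?_ hzk
      gcongr
    have hi0 : (0:ℝ) ≤ i * h := by positivity
    push_cast at hiz ⊢
    have hSJ : Set.Ioc ((i:ℝ) * h) ((i + 1) * h) ⊆ J := fun y hy =>
      hJ.out h0J hz ⟨by linarith [hy.1], by linarith [hy.2]⟩
    by_contra hcon
    push Not at hcon
    set lm : ℝ := 19 ^ i * lam with hlm
    have hlm1 : 1 ≤ lm := one_le_mul_of_one_le_of_one_le (one_le_pow₀ (by norm_num)) hlam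
    have elm : (19:ℝ) ^ (i+1) * lam = 19 * lm := by rw [hlm]; ring
    rw [elm] at hcon
    obtain ⟨N, hN, hlow⟩ := step_analytic J hJ g hg B hB hB0 p (2 * h) h (Real.exp (1 - 19 * lm)) lm
      hpJ hlm1 hgp hBh (Set.Ioc ((i:ℝ) * h) ((i + 1) * h)) hSJ
      (fun y hy => ⟨by linarith [hy.1], by linarith [hy.2]⟩) hh (by linarith)
      (by rw [Real.volume_Ioc]; apply ENNReal.ofReal_le_ofReal; linarith) (Real.exp_pos _).le
      (fun y hy => (hcon y (hSJ hy) (by linarith [hy.1]) hy.2).le)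
    have e1 : 8 * Real.exp 1 * (2 * h) / h = 8 * Real.exp 1 * 2 := by field_simp
    rw [e1] at hlow
    have h2 : (8 * Real.exp 1 * 2) ^ N ≤ Real.exp (4 * (lm + 3)) := by
      calc _ ≤ (Real.exp 4) ^ N := by gcongr; exact exp_bound16
        _ = Real.exp (N * 4) := by rw [Real.exp_nat_mul]
        _ ≤ _ := Real.exp_le_exp.2 (by linarith)
    have h3 : Real.exp (-lm) ≤ Real.exp (4 * (lm + 3) + (1 - 19 * lm)) := by
      rw [Real.exp_add]
      refine hlow.trans ?_
      gcongr
    have := Real.exp_le_exp.1 h3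
    linarith

theorem pigeon (S : Set ℝ) (N : ℕ) (hN : 0 < N) (h δ : ℝ) (hh : 0 < h) (hδ : 0 < δ)
    (hS : S ⊆ Set.Ioc 0 (N * h)) (hvol : ENNReal.ofReal δ ≤ volume S) :
    ∃ k < N, ENNReal.ofReal (δ / (2 * N)) ≤ volume (S ∩ Set.Ioc ((k:ℝ) * h) ((k + 1) * h)) := by
  by_contra hcon
  push Not at hcon
  have hsub : S ⊆ ⋃ k ∈ Finset.range N, (S ∩ Set.Ioc ((k:ℝ) * h) ((k + 1) * h)) := by
    intro y hy
    have hy' := hS hy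
    have hpos : 0 < ⌈y / h⌉₊ := Nat.ceil_pos.2 (div_pos hy'.1 hh)
    obtain ⟨k, hk⟩ : ∃ k, ⌈y / h⌉₊ = k + 1 := ⟨⌈y / h⌉₊ - 1, by omega⟩
    have h1 : y / h ≤ k + 1 := by have := Nat.le_ceil (y / h); rw [hk] at this; exact_mod_cast this
    have h2 : (k:ℝ) < y / h := Nat.lt_ceil.1 (by omega)
    have h3 : k + 1 ≤ N := by
      rw [← hk]; apply Nat.ceil_le.2
      rw [div_le_iff₀ hh]; exact hy'.2
    simp only [Set.mem_iUnion]
    refine ⟨k, by simp; omega, hy, ?_, ?_⟩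
    · rwa [lt_div_iff₀ hh] at h2
    · rwa [div_le_iff₀ hh] at h1
  have h1 : volume S ≤ ENNReal.ofReal (δ / 2) := by
    refine (measure_mono hsub).trans ((measure_biUnion_finset_le _ _).trans ?_)
    calc _ ≤ ∑ k ∈ Finset.range N, ENNReal.ofReal (δ / (2 * N)) :=
          Finset.sum_le_sum fun k hk => (hcon k (Finset.mem_range.1 hk)).le
      _ = ENNReal.ofReal (δ / 2) := by
          rw [Finset.sum_const, Finset.card_range, nsmul_eq_mul, ← ENNReal.ofReal_natCast,
            ← ENNReal.ofReal_mul (by positivity)]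
          congr 1
          have : (N:ℝ) ≠ 0 := by positivity
          field_simp
  have h2 := hvol.trans h1
  rw [ENNReal.ofReal_le_ofReal_iff (by positivity)] at h2
  linarith

set_option maxHeartbeats 2000000 in
theorem main_eq (d : ℕ) (hd : 1 ≤ d) :
    ∃ K : ℝ, 1 ≤ K ∧
      ∀ (A R t γ : ℝ), 1 ≤ A → 0 < R → 0 < t → t ≤ 1 → 0 < γ → γ ≤ 1 →
        ∀ E : Set (Esp d), E ⊆ Metric.ball 0 R → MeasurableSet E →
          ENNReal.ofReal γ * volume (Metric.ball (0 : Esp d) R) ≤ volume E →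
          ∀ f : Esp d → ℂ, CMU (gevreySeq A 1) (Metric.ball 0 R) f →
          ∀ x0 ∈ Metric.ball (0 : Esp d) R, t / 2 ≤ ‖f x0‖ →
          ∀ σ : ℝ, 0 ≤ σ → (∀ x ∈ E, ‖f x‖ ≤ σ) →
          1 ≤ (K / γ) ^ (K * ((1 - Real.log t) * Real.exp (K * A * R))) * σ := by
  have hd0 : (1:ℝ) ≤ d := by exact_mod_cast hd
  set c : ℝ := 8 * Real.exp 1 * 8 * (d * 2 ^ d) with hc
  have hce : Real.exp 1 ≤ c := by
    have h2 : (1:ℝ) ≤ 2 ^ d := one_le_pow₀ (by norm_num)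
    have : 1 ≤ (d:ℝ) * 2 ^ d := one_le_mul_of_one_le_of_one_le hd0 h2
    have := Real.exp_pos 1
    nlinarith
  have he0 := Real.exp_pos 1
  have hK1 : c ≤ c + 190 + 12 * Real.exp 1 * d := by
    have : 0 < 12 * Real.exp 1 * d := by positivity
    linarith
  have hK2 : 190 ≤ c + 190 + 12 * Real.exp 1 * d := by
    have : 0 < 12 * Real.exp 1 * d := by positivity
    linarith
  have hK3 : 12 * Real.exp 1 * d ≤ c + 190 + 12 * Real.exp 1 * d := by linarith
  set K : ℝ := c + 190 + 12 * Real.exp 1 * d with hK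
  refine ⟨K, by linarith, ?_⟩
  clear_value K
  intro A R t γ hA hR ht ht1 hγ hγ1 E hE hm hvol f hf x0 hx0 hfx0 σ hσ0 hσ
  obtain ⟨J, g, S, hJ, hg, hgb, h0J, hg0, hSJ, hSI, hSv, hSσ⟩ :=
    ray_data 1 A R γ d hd hR hγ E hE hm hvol f hf x0 hx0 σ hσ
  simp only [Real.rpow_one] at hgb
  have hlog : 0 ≤ - Real.log t := by linarith [Real.log_nonpos ht.le ht1]
  set B : ℝ := d * A with hB
  have hB0 : 0 < B := by positivity
  set P : ℕ := ⌈4 * Real.exp 1 * B * R⌉₊ with hP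
  have hPpos : 0 < P := Nat.ceil_pos.2 (by positivity)
  have hP0 : (0:ℝ) < P := by exact_mod_cast hPpos
  have hP1 : 4 * Real.exp 1 * B * R ≤ P := Nat.le_ceil _
  have hP2 : (P:ℝ) < 4 * Real.exp 1 * B * R + 1 := Nat.ceil_lt_add_one (by positivity)
  set h : ℝ := 2 * R / P with hh
  have hh0 : 0 < h := by positivity
  have hPh : (P:ℝ) * h = 2 * R := by rw [hh]; field_simp
  have hBh : B * (2 * h) ≤ Real.exp (-1) := by
    rw [hh, Real.exp_neg, ← one_div, le_div_iff₀ he0]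
    have : B * (2 * (2 * R / P)) * Real.exp 1 = (4 * Real.exp 1 * B * R) / P := by ring
    rw [this, div_le_one hP0]; exact hP1
  set δ : ℝ := γ * R / (d * 2 ^ d) with hδ
  have hδ0 : 0 < δ := by positivity
  have hδR : δ ≤ R := delta_le d hd R γ hR hγ1
  obtain ⟨k, hkP, hkv⟩ := pigeon S P hPpos h δ hh0 hδ0 (by rw [hPh]; exact hSI) hSv
  have hδP : 0 < δ / (2 * P) := by positivity
  obtain ⟨z, hzS, hz⟩ : (S ∩ Set.Ioc ((k:ℝ) * h) ((k + 1) * h)).Nonempty := by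
    apply nonempty_of_measure_ne_zero (μ := volume)
    exact (lt_of_lt_of_le (ENNReal.ofReal_pos.2 hδP) hkv).ne'
  set l0 : ℝ := 2 * (1 - Real.log t) with hl0
  have hl01 : 1 ≤ l0 := by linarith
  have hge : 2 ≤ Real.exp 1 := by have := Real.add_one_le_exp (1:ℝ); linarith
  have hstart : Real.exp (1 - l0) ≤ ‖g 0 0‖ := by
    rw [hg0]
    refine le_trans ?_ hfx0
    calc Real.exp (1 - l0) ≤ Real.exp (-1 + Real.log t) := Real.exp_le_exp.2 (by linarith)
      _ = Real.exp (-1) * t := by rw [Real.exp_add, Real.exp_log ht]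
      _ ≤ (1 / 2) * t := by
          gcongr
          rw [Real.exp_neg, one_div]
          exact inv_anti₀ (by norm_num) hge
      _ = _ := by ring
  obtain ⟨p, hpJ, hp1, hp2, hgp⟩ := chain_analytic J hJ g hg B hgb hB0.le h l0 hh0 h0J hl01 hstart
    hBh k z (hSJ hzS) hz.1.le k le_rfl
  set lk : ℝ := 19 ^ k * l0 with hlk
  have hlk1 : 1 ≤ lk := one_le_mul_of_one_le_of_one_le (one_le_pow₀ (by norm_num)) hl01
  obtain ⟨N, hN, hlow⟩ := step_analytic J hJ g hg B hgb hB0.le p (2 * h) (δ / (2 * P)) σ lk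
    hpJ hlk1 hgp hBh (S ∩ Set.Ioc ((k:ℝ) * h) ((k + 1) * h)) (Set.inter_subset_left.trans hSJ)
    (fun y hy => ⟨by linarith [hy.2.1], by linarith [hy.2.2]⟩) hδP
    (by
      rw [hh, div_le_iff₀ (by positivity)]
      have : 2 * (2 * R / (P:ℝ)) * (2 * P) = 8 * R := by field_simp; ring
      rw [this]; linarith) hkv hσ0 (fun y hy => hSσ y hy.1)
  have hG : 8 * Real.exp 1 * (2 * h) / (δ / (2 * P)) = c / γ := by
    rw [hh, hδ, hc]; field_simp; ring
  rw [hG] at hlow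
  refine final_pow c γ lk (lk + 3) K _ σ hce hγ hγ1 hσ0 N hlow hN ?_ (by linarith) hK1
  have h19 : (19:ℝ) ≤ Real.exp 3 := by
    have e3 : Real.exp 3 = Real.exp 1 ^ 3 := by rw [← Real.exp_nat_mul]; norm_num
    have h1 : (2.7:ℝ) ≤ Real.exp 1 := by have := Real.exp_one_gt_d9; linarith
    rw [e3]
    calc (19:ℝ) ≤ 2.7 ^ 3 := by norm_num
      _ ≤ _ := by gcongr
  have hk1 : (k:ℝ) ≤ 4 * Real.exp 1 * B * R := by
    have : (k:ℝ) + 1 ≤ P := by exact_mod_cast hkP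
    linarith
  have h19k : (19:ℝ) ^ k ≤ Real.exp (K * A * R) := by
    calc (19:ℝ) ^ k ≤ Real.exp 3 ^ k := by gcongr
      _ = Real.exp (k * 3) := by rw [Real.exp_nat_mul]
      _ ≤ Real.exp (12 * Real.exp 1 * d * A * R) := Real.exp_le_exp.2 (by rw [hB] at hk1; linarith)
      _ ≤ _ := Real.exp_le_exp.2 (by gcongr)
  have hlk2 : lk ≤ 2 * ((1 - Real.log t) * Real.exp (K * A * R)) := by
    rw [hlk, hl0]
    have h5 : 0 ≤ 1 - Real.log t := by linarith
    calc (19:ℝ) ^ k * (2 * (1 - Real.log t)) ≤ Real.exp (K * A * R) * (2 * (1 - Real.log t)) :=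
          mul_le_mul_of_nonneg_right h19k (by linarith)
      _ = _ := by ring
  have hX0 : 0 ≤ (1 - Real.log t) * Real.exp (K * A * R) := by linarith
  calc lk + (lk + 3) ≤ 190 * ((1 - Real.log t) * Real.exp (K * A * R)) := by linarith
    _ ≤ K * ((1 - Real.log t) * Real.exp (K * A * R)) := mul_le_mul_of_nonneg_right hK2 hX0

/-- Chebyshev step from sup bounds to `L²` bounds. -/
theorem l2_core {d : ℕ} (R γ : ℝ) (hR : 0 < R) (hγ : 0 < γ) (hγ1 : γ ≤ 1) (E : Set (Esp d))
    (hE : E ⊆ Metric.ball 0 R) (hm : MeasurableSet E)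
    (hvol : ENNReal.ofReal γ * volume (Metric.ball (0 : Esp d) R) ≤ volume E)
    (f : Esp d → ℂ) (hc : ContinuousOn f (Metric.ball 0 R))
    (hb : ∀ x ∈ Metric.ball (0 : Esp d) R, ‖f x‖ ≤ 1) (G : ℝ) (hG : 0 ≤ G)
    (H : ∀ E' : Set (Esp d), E' ⊆ Metric.ball 0 R → MeasurableSet E' →
      ENNReal.ofReal (γ / 2) * volume (Metric.ball (0 : Esp d) R) ≤ volume E' →
      ∀ σ : ℝ, 0 ≤ σ → (∀ x ∈ E', ‖f x‖ ≤ σ) → 1 ≤ G * σ) :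
    eLpNorm f 2 (volume.restrict (Metric.ball 0 R)) ≤
      ENNReal.ofReal (G * (2 / γ)) * eLpNorm f 2 (volume.restrict E) := by
  set V := volume (Metric.ball (0 : Esp d) R) with hV
  have hVtop : V ≠ ∞ := measure_ball_lt_top.ne
  have hV0 : V ≠ 0 := (Metric.measure_ball_pos volume _ hR).ne'
  have hEtop : volume E ≠ ∞ := ((measure_mono hE).trans_lt measure_ball_lt_top).ne
  have hE0 : volume E ≠ 0 := by
    intro h
    rw [h] at hvol
    have := le_antisymm hvol (zero_le)
    rw [mul_eq_zero] at this
    rcases this with h | h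
    · exact absurd hγ (by simpa using h)
    · exact hV0 h
  set v : ℝ := (volume E).toReal with hv
  have hv0 : 0 < v := ENNReal.toReal_pos hE0 hEtop
  have hvV : γ * V.toReal ≤ v := by
    have := ENNReal.toReal_mono hEtop hvol
    rwa [ENNReal.toReal_mul, ENNReal.toReal_ofReal hγ.le] at this
  set W : ℝ := V.toReal with hW
  have hW0 : 0 < W := ENNReal.toReal_pos hV0 hVtop
  have hcE : ContinuousOn f E := hc.mono hE
  have hsm : AEStronglyMeasurable f (volume.restrict E) := hcE.aestronglyMeasurable hm
  set n := eLpNorm f 2 (volume.restrict E) with hn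
  have hntop : n ≠ ∞ := by
    have : n ≤ _ := eLpNorm_le_of_ae_bound (C := 1)
      ((ae_restrict_iff' hm).2 (ae_of_all _ fun x hx => hb x (hE hx)))
    refine (this.trans_lt ?_).ne
    refine ENNReal.mul_lt_top (ENNReal.rpow_lt_top_of_nonneg (by simp) (by simpa using hEtop)) (by simp)
  -- upper bound on the ball
  have hup : eLpNorm f 2 (volume.restrict (Metric.ball 0 R)) ≤ ENNReal.ofReal (Real.sqrt W) := by
    have := eLpNorm_le_of_ae_bound (p := 2) (C := 1) (f := f)
      (μ := volume.restrict (Metric.ball (0 : Esp d) R))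
      ((ae_restrict_iff' measurableSet_ball).2 (ae_of_all _ fun x hx => hb x hx))
    refine this.trans ?_
    rw [Measure.restrict_apply_univ, ← hV, ← ENNReal.ofReal_toReal hVtop,
      ENNReal.ofReal_rpow_of_nonneg hW0.le (by simp)]
    simp only [ENNReal.ofReal_one, mul_one, ENNReal.toReal_ofNat]
    rw [Real.sqrt_eq_rpow, one_div]
  -- Chebyshev
  set σ : ℝ := Real.sqrt (2 / v) * n.toReal with hσ
  have hσ0 : 0 ≤ σ := by positivity
  have key : ∀ τ : ℝ, σ < τ → 1 ≤ G * τ := by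
    intro τ hτ
    have hτ0 : 0 < τ := hσ0.trans_lt hτ
    obtain ⟨u, hu, hu2⟩ := (continuousOn_iff'.1 hcE.norm) (Set.Ioi τ) isOpen_Ioi
    have hbad : MeasurableSet ({x | τ < ‖f x‖} ∩ E) := by
      have : {x | τ < ‖f x‖} ∩ E = u ∩ E := by rw [← hu2]; rfl
      rw [this]; exact hu.measurableSet.inter hm
    have hsub : E \ ({x | τ < ‖f x‖} ∩ E) ⊆ Metric.ball 0 R := Set.sdiff_subset.trans hE
    refine H (E \ ({x | τ < ‖f x‖} ∩ E)) hsub (hm.diff hbad) ?_ τ hτ0.le ?_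
    swap
    · rintro x ⟨hx, hx2⟩
      by_contra h
      exact hx2 ⟨lt_of_not_ge h, hx⟩
    have hch := mul_meas_ge_le_pow_eLpNorm' (volume.restrict E) (p := 2) (by simp) (by simp) hsm
      (ENNReal.ofReal τ)
    have hbv : volume ({x | τ < ‖f x‖} ∩ E) ≤ ENNReal.ofReal (v / 2) := by
      have h1 : volume ({x | τ < ‖f x‖} ∩ E) ≤
          (volume.restrict E) {x | ENNReal.ofReal τ ≤ ‖f x‖ₑ} := by
        rw [Measure.restrict_apply' hm]
        apply measure_mono
        rintro x ⟨hx, hxE⟩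
        refine ⟨?_, hxE⟩
        simp only [Set.mem_ofPred_eq] at hx ⊢
        rw [← ofReal_norm]
        exact ENNReal.ofReal_le_ofReal hx.le
      have h2 : ENNReal.ofReal (τ ^ 2) * volume ({x | τ < ‖f x‖} ∩ E) ≤
          ENNReal.ofReal (n.toReal ^ 2) := by
        have e1 : ENNReal.ofReal (n.toReal ^ 2) = n ^ (2:ℝ) := by
          rw [ENNReal.ofReal_pow (by positivity), ENNReal.ofReal_toReal hntop]; norm_cast
        have e2 : ENNReal.ofReal (τ ^ 2) = ENNReal.ofReal τ ^ (2:ℝ) := by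
          rw [ENNReal.ofReal_pow hτ0.le]; norm_cast
        rw [e1, e2]
        refine le_trans (mul_le_mul_right h1 _) ?_
        simpa using hch
      have hfin : volume ({x | τ < ‖f x‖} ∩ E) ≠ ∞ :=
        ((measure_mono Set.inter_subset_right).trans_lt hEtop.lt_top).ne
      rw [← ENNReal.ofReal_toReal hfin] at h2 ⊢
      rw [← ENNReal.ofReal_mul (by positivity), ENNReal.ofReal_le_ofReal_iff (by positivity)] at h2
      apply ENNReal.ofReal_le_ofReal
      set q := (volume ({x | τ < ‖f x‖} ∩ E)).toReal
      have hs2 : σ ^ 2 = 2 / v * n.toReal ^ 2 := by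
        rw [hσ, mul_pow, Real.sq_sqrt (by positivity)]
      have hn2 : n.toReal ^ 2 = v / 2 * σ ^ 2 := by rw [hs2]; field_simp
      rw [hn2] at h2
      have h3 : σ ^ 2 ≤ τ ^ 2 := by gcongr
      have h4 : τ ^ 2 * q ≤ τ ^ 2 * (v / 2) := by
        calc _ ≤ v / 2 * σ ^ 2 := h2
          _ ≤ v / 2 * τ ^ 2 := by gcongr
          _ = _ := by ring
      exact le_of_mul_le_mul_left h4 (by positivity)
    have h5 : volume E ≤ volume (E \ ({x | τ < ‖f x‖} ∩ E)) + ENNReal.ofReal (v / 2) := by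
      calc volume E ≤ volume ((E \ ({x | τ < ‖f x‖} ∩ E)) ∪ ({x | τ < ‖f x‖} ∩ E)) :=
            measure_mono (by intro x hx; by_cases h : x ∈ ({x | τ < ‖f x‖} ∩ E)
                             · exact Or.inr h
                             · exact Or.inl ⟨hx, h⟩)
        _ ≤ _ := measure_union_le _ _
        _ ≤ _ := by gcongr
    have hfin : volume (E \ ({x | τ < ‖f x‖} ∩ E)) ≠ ∞ :=
      ((measure_mono Set.sdiff_subset).trans_lt hEtop.lt_top).ne
    rw [← ENNReal.ofReal_toReal hfin] at h5 ⊢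
    rw [← ENNReal.ofReal_toReal hEtop, ← ENNReal.ofReal_add (by positivity) (by positivity),
      ENNReal.ofReal_le_ofReal_iff (by positivity)] at h5
    rw [← ENNReal.ofReal_toReal hVtop, ← ENNReal.ofReal_mul (by positivity)]
    apply ENNReal.ofReal_le_ofReal
    change γ / 2 * W ≤ _
    change v ≤ _ at h5
    linarith
  have hfinal : 1 ≤ G * σ := by
    have h1 : Tendsto (fun τ => G * τ) (nhdsWithin σ (Set.Ioi σ)) (nhds (G * σ)) :=
      ((continuous_const.mul continuous_id).tendsto σ).mono_left nhdsWithin_le_nhds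
    exact ge_of_tendsto h1 (eventually_nhdsWithin_of_forall key)
  refine hup.trans ?_
  rw [← ENNReal.ofReal_toReal hntop, ← ENNReal.ofReal_mul (by positivity)]
  apply ENNReal.ofReal_le_ofReal
  have h6 : Real.sqrt W * Real.sqrt (2 / v) ≤ 2 / γ := by
    rw [← Real.sqrt_mul hW0.le]
    have h7 : W * (2 / v) ≤ 2 / γ := by
      rw [← mul_div_assoc, div_le_div_iff₀ hv0 hγ]
      nlinarith
    have h8 : 1 ≤ 2 / γ := by rw [le_div_iff₀ hγ]; linarith
    calc Real.sqrt (W * (2 / v)) ≤ Real.sqrt ((2 / γ) ^ 2) := by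
          apply Real.sqrt_le_sqrt
          nlinarith
      _ = 2 / γ := Real.sqrt_sq (by linarith)
  calc Real.sqrt W = Real.sqrt W * 1 := by ring
    _ ≤ Real.sqrt W * (G * σ) := by gcongr
    _ = G * (Real.sqrt W * Real.sqrt (2 / v)) * n.toReal := by rw [hσ]; ring
    _ ≤ G * (2 / γ) * n.toReal := by gcongr

theorem pow_mono_K (K0 X X' γ : ℝ) (hK : 1 ≤ K0) (hX : 1 ≤ X) (hXX : X ≤ X') (hγ : 0 < γ)
    (hγ1 : γ ≤ 1) :
    (K0 / γ) ^ (K0 * X) ≤ ((2 * K0 + 1) / γ) ^ ((2 * K0 + 1) * X') ∧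
    (K0 / (γ / 2)) ^ (K0 * X) * (2 / γ) ≤ ((2 * K0 + 1) / γ) ^ ((2 * K0 + 1) * X') := by
  have hb : 1 ≤ (2 * K0 + 1) / γ := by rw [le_div_iff₀ hγ]; linarith
  have hKX : 1 ≤ K0 * X := one_le_mul_of_one_le_of_one_le hK hX
  have h1 : K0 * X + 1 ≤ (2 * K0 + 1) * X' := by
    calc K0 * X + 1 ≤ (2 * K0 + 1) * X := by nlinarith
      _ ≤ _ := by gcongr
  constructor
  · calc (K0 / γ) ^ (K0 * X) ≤ ((2 * K0 + 1) / γ) ^ (K0 * X) := by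
          apply Real.rpow_le_rpow (by positivity) _ (by linarith)
          gcongr; linarith
      _ ≤ _ := Real.rpow_le_rpow_of_exponent_le hb (by linarith)
  · have e : K0 / (γ / 2) = 2 * K0 / γ := by field_simp
    rw [e]
    calc (2 * K0 / γ) ^ (K0 * X) * (2 / γ)
        ≤ ((2 * K0 + 1) / γ) ^ (K0 * X) * ((2 * K0 + 1) / γ) := by
          apply mul_le_mul _ _ (by positivity) (by positivity)
          · apply Real.rpow_le_rpow (by positivity) _ (by linarith)
            gcongr; linarith
          · gcongr; linarith
      _ = ((2 * K0 + 1) / γ) ^ (K0 * X + 1) := by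
          rw [Real.rpow_add (by positivity), Real.rpow_one]
      _ ≤ _ := Real.rpow_le_rpow_of_exponent_le hb h1

theorem cmu_le_one {d : ℕ} (A s R : ℝ) (f : Esp d → ℂ)
    (hf : CMU (gevreySeq A s) (Metric.ball 0 R) f) (x : Esp d) (hx : x ∈ Metric.ball (0 : Esp d) R) :
    ‖f x‖ ≤ 1 := by
  have h := hf.2 0 x hx
  have h0 := tow_zero f x 0 0
  have : ∀ l : List (Fin d), l.foldr (fun i g => (pderivI i)^[(0 : Fin d → ℕ) i] g) f = f := by
    intro l; induction l with
    | nil => rfl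
    | cons a l ih => simp only [List.foldr_cons, ih]; rfl
  rw [mderiv_eq_foldr, this] at h
  simpa [gevreySeq] using h

theorem both_of_main {d : ℕ} (A s R t γ K0 X X' : ℝ) (hR : 0 < R) (ht : 0 < t)
    (hγ : 0 < γ) (hγ1 : γ ≤ 1) (hK : 1 ≤ K0) (hX : 1 ≤ X) (hXX : X ≤ X') (E : Set (Esp d))
    (hE : E ⊆ Metric.ball 0 R) (hm : MeasurableSet E)
    (hvol : ENNReal.ofReal γ * volume (Metric.ball (0 : Esp d) R) ≤ volume E)
    (f : Esp d → ℂ) (hf : CMU (gevreySeq A s) (Metric.ball 0 R) f)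
    (hsup : t ≤ (⨆ x : Metric.ball (0 : Esp d) R, ‖f (x : Esp d)‖))
    (H : ∀ γ' : ℝ, 0 < γ' → γ' ≤ 1 → ∀ E' : Set (Esp d), E' ⊆ Metric.ball 0 R → MeasurableSet E' →
      ENNReal.ofReal γ' * volume (Metric.ball (0 : Esp d) R) ≤ volume E' →
      ∀ x0 ∈ Metric.ball (0 : Esp d) R, t / 2 ≤ ‖f x0‖ →
      ∀ σ : ℝ, 0 ≤ σ → (∀ x ∈ E', ‖f x‖ ≤ σ) → 1 ≤ (K0 / γ') ^ (K0 * X) * σ) :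
    (⨆ x : Metric.ball (0 : Esp d) R, ‖f (x : Esp d)‖) ≤
        ((2 * K0 + 1) / γ) ^ ((2 * K0 + 1) * X') * (⨆ x : E, ‖f (x : Esp d)‖) ∧
      eLpNorm f 2 (volume.restrict (Metric.ball 0 R)) ≤
        ENNReal.ofReal (((2 * K0 + 1) / γ) ^ ((2 * K0 + 1) * X')) *
          eLpNorm f 2 (volume.restrict E) := by
  have hb := cmu_le_one A s R f hf
  obtain ⟨hm1, hm2⟩ := pow_mono_K K0 X X' γ hK hX hXX hγ hγ1
  have : Nonempty (Metric.ball (0 : Esp d) R) := ⟨⟨0, Metric.mem_ball_self hR⟩⟩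
  obtain ⟨⟨x0, hx0⟩, hfx⟩ := exists_lt_of_lt_ciSup (lt_of_lt_of_le (half_lt_self ht) hsup)
  constructor
  · have hbdd : BddAbove (Set.range fun x : E => ‖f (x : Esp d)‖) :=
      ⟨1, by rintro _ ⟨x, rfl⟩; exact hb x (hE x.2)⟩
    have hσ0 : 0 ≤ (⨆ x : E, ‖f (x : Esp d)‖) := Real.iSup_nonneg fun _ => norm_nonneg _
    calc (⨆ x : Metric.ball (0 : Esp d) R, ‖f (x : Esp d)‖) ≤ 1 := ciSup_le fun x => hb x x.2
      _ ≤ (K0 / γ) ^ (K0 * X) * (⨆ x : E, ‖f (x : Esp d)‖) :=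
          H γ hγ hγ1 E hE hm hvol x0 hx0 hfx.le _ hσ0 fun x hx => le_ciSup hbdd ⟨x, hx⟩
      _ ≤ _ := mul_le_mul_of_nonneg_right hm1 hσ0
  · refine (l2_core R γ hR hγ hγ1 E hE hm hvol f hf.1.continuousOn hb
      ((K0 / (γ / 2)) ^ (K0 * X)) (by positivity) ?_).trans ?_
    · intro E' hE' hm' hv' σ hσ0 hσ
      exact H (γ / 2) (by linarith) (by linarith) E' hE' hm' hv' x0 hx0 hfx.le σ hσ0 hσ
    · exact mul_le_mul_left (ENNReal.ofReal_le_ofReal hm2) _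

/-- Quantitative Nazarov–Sodin–Volberg estimates on Euclidean balls for the
sequences `(A^p (p!)^s)_p` (Example `NSV_example`). -/
theorem stmt_16 (s : ℝ) (hs0 : 0 < s) (hs1 : s ≤ 1) (d : ℕ) (hd : 1 ≤ d) :
    ∃ K : ℝ, 1 ≤ K ∧
      ∀ (A R t γ : ℝ), 1 ≤ A → 0 < R → 0 < t → t ≤ 1 → 0 < γ → γ ≤ 1 →
        ∀ E : Set (Esp d), E ⊆ Metric.ball 0 R → MeasurableSet E →
          ENNReal.ofReal γ * volume (Metric.ball (0 : Esp d) R) ≤ volume E →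
          ∀ f : Esp d → ℂ, CMU (gevreySeq A s) (Metric.ball 0 R) f →
            t ≤ (⨆ x : Metric.ball (0 : Esp d) R, ‖f (x : Esp d)‖) →
            (s < 1 →
              (⨆ x : Metric.ball (0 : Esp d) R, ‖f (x : Esp d)‖) ≤
                (K / γ) ^ (K * (1 - Real.log t + (A * R) ^ (1 / (1 - s)))) *
                  (⨆ x : E, ‖f (x : Esp d)‖) ∧
              eLpNorm f 2 (volume.restrict (Metric.ball 0 R)) ≤
                ENNReal.ofReal
                    ((K / γ) ^ (K * (1 - Real.log t + (A * R) ^ (1 / (1 - s))))) *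
                  eLpNorm f 2 (volume.restrict E)) ∧
            (s = 1 →
              (⨆ x : Metric.ball (0 : Esp d) R, ‖f (x : Esp d)‖) ≤
                (K / γ) ^ (K * (1 - Real.log t) * Real.exp (K * A * R)) *
                  (⨆ x : E, ‖f (x : Esp d)‖) ∧
              eLpNorm f 2 (volume.restrict (Metric.ball 0 R)) ≤
                ENNReal.ofReal
                    ((K / γ) ^ (K * (1 - Real.log t) * Real.exp (K * A * R))) *
                  eLpNorm f 2 (volume.restrict E)) := by
  rcases hs1.lt_or_eq with h | h
  · obtain ⟨K0, hK, H⟩ := main_lt s hs0 h d hd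
    refine ⟨2 * K0 + 1, by linarith, ?_⟩
    intro A R t γ hA hR ht ht1 hγ hγ1 E hE hm hvol f hf hsup
    refine ⟨fun _ => ?_, fun h' => absurd h' h.ne⟩
    have hX : 1 ≤ 1 - Real.log t + (A * R) ^ (1 / (1 - s)) := by
      have h1 := Real.log_nonpos ht.le ht1
      have h2 : 0 ≤ (A * R) ^ (1 / (1 - s)) := by positivity
      linarith
    exact both_of_main A s R t γ K0 _ _ hR ht hγ hγ1 hK hX le_rfl E hE hm hvol f hf hsup
      fun γ' h1 h2 E' h3 h4 h5 => H A R t γ' hA hR ht ht1 h1 h2 E' h3 h4 h5 f hf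
  · subst h
    obtain ⟨K0, hK, H⟩ := main_eq d hd
    refine ⟨2 * K0 + 1, by linarith, ?_⟩
    intro A R t γ hA hR ht ht1 hγ hγ1 E hE hm hvol f hf hsup
    refine ⟨fun h' => absurd h' (lt_irrefl _), fun _ => ?_⟩
    have h1 : 1 ≤ 1 - Real.log t := by linarith [Real.log_nonpos ht.le ht1]
    have hAR : 0 < A * R := by positivity
    have hX : 1 ≤ (1 - Real.log t) * Real.exp (K0 * A * R) :=
      one_le_mul_of_one_le_of_one_le h1 (Real.one_le_exp (by positivity))
    have hXX : (1 - Real.log t) * Real.exp (K0 * A * R) ≤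
        (1 - Real.log t) * Real.exp ((2 * K0 + 1) * A * R) := by
      gcongr
      linarith
    rw [mul_assoc (2 * K0 + 1) (1 - Real.log t)]
    exact both_of_main A 1 R t γ K0 _ _ hR ht hγ hγ1 hK hX hXX E hE hm hvol f hf hsup
      fun γ' h1 h2 E' h3 h4 h5 => H A R t γ' hA hR ht ht1 h1 h2 E' h3 h4 h5 f hf

end
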